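/- arXiv:1509.07003 — 12 statements merged into one kernel-verified Lean document; each statement's English description precedes it below -/
import Mathlib

section
/- Let μ > 0 and κ > 0, and define Q₃(M) = 2μ·|sym M|² + κ·(tr M)² for M ∈ ℝ^{3×3}. Then for every G ∈ ℝ^{2×2}, the minimum over all a ∈ ℝ and b ∈ ℝ² of Q₃ applied to the 3×3 block matrix whose upper-left 2×2 block is G, whose upper-right 2×1 block is b, whose lower-left 1×2 block is 0, and whose (3,3) entry is a, equals 2μ·(|sym G|² + γ·(tr G)²), where γ = κ/(2μ + κ). The minimum is attained at b = 0 and a = −κ·tr G/(2μ + κ). -/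
open Matrix Real

/-- Frobenius norm squared of a real square matrix. -/
noncomputable def frobSq {ι : Type*} [Fintype ι] (M : Matrix ι ι ℝ) : ℝ :=
  ∑ i, ∑ j, (M i j) ^ 2

/-- Symmetric part of a square matrix. -/
noncomputable def symPart {ι : Type*} [Fintype ι] (M : Matrix ι ι ℝ) : Matrix ι ι ℝ :=
  (1 / 2 : ℝ) • (M + Mᵀ)

/-- The quadratic form `Q₃(M) = 2μ |sym M|² + κ (tr M)²`, on 3×3 matrices indexed by
`Fin 2 ⊕ Fin 1` (row/column 3 corresponding to `Sum.inr`). -/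
noncomputable def Q₃ (μ κ : ℝ) (M : Matrix (Fin 2 ⊕ Fin 1) (Fin 2 ⊕ Fin 1) ℝ) : ℝ :=
  2 * μ * frobSq (symPart M) + κ * (M.trace) ^ 2

/-- The 3×3 block matrix with upper-left block `G`, upper-right block `b`,
lower-left block `0` and (3,3) entry `a`. -/
noncomputable def blockMat (G : Matrix (Fin 2) (Fin 2) ℝ) (b : Fin 2 → ℝ) (a : ℝ) :
    Matrix (Fin 2 ⊕ Fin 1) (Fin 2 ⊕ Fin 1) ℝ :=
  Matrix.fromBlocks G (Matrix.of fun i (_ : Fin 1) => b i) 0 (Matrix.of fun _ _ => a)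

/-- Completing the square in `a` separates the minimization over `a` and `b`. -/
theorem Q₃_blockMat (μ κ : ℝ) (h : 2 * μ + κ ≠ 0) (G : Matrix (Fin 2) (Fin 2) ℝ)
    (b : Fin 2 → ℝ) (a : ℝ) :
    Q₃ μ κ (blockMat G b a) =
      2 * μ * (frobSq (symPart G) + (κ / (2 * μ + κ)) * (G.trace) ^ 2) +
        (2 * μ + κ) * (a - -(κ * G.trace) / (2 * μ + κ)) ^ 2 + μ * ∑ i, b i ^ 2 := by
  simp only [Q₃, blockMat, frobSq, symPart, Matrix.trace, Matrix.diag, Matrix.smul_apply,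
    Matrix.add_apply, Matrix.transpose_apply, Fintype.sum_sum_type, Fin.sum_univ_two,
    Fin.sum_univ_one, Matrix.fromBlocks_apply₁₁, Matrix.fromBlocks_apply₁₂,
    Matrix.fromBlocks_apply₂₁, Matrix.fromBlocks_apply₂₂, Matrix.of_apply, Matrix.zero_apply,
    smul_eq_mul]
  field_simp
  ring

/-- minimizing `Q₃` over the last row/column gives
`Q₂(G) = 2μ (|sym G|² + γ (tr G)²)` with `γ = κ/(2μ+κ)`, the minimum being attained at
`b = 0`, `a = −κ tr G/(2μ+κ)`. -/
theorem stmt2 (μ κ : ℝ) (hμ : 0 < μ) (hκ : 0 < κ) (G : Matrix (Fin 2) (Fin 2) ℝ) :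
    IsLeast {x : ℝ | ∃ (a : ℝ) (b : Fin 2 → ℝ), x = Q₃ μ κ (blockMat G b a)}
      (2 * μ * (frobSq (symPart G) + (κ / (2 * μ + κ)) * (G.trace) ^ 2)) ∧
    Q₃ μ κ (blockMat G 0 (-(κ * G.trace) / (2 * μ + κ))) =
      2 * μ * (frobSq (symPart G) + (κ / (2 * μ + κ)) * (G.trace) ^ 2) := by
  have h : 0 < 2 * μ + κ := by positivity
  have hmin : Q₃ μ κ (blockMat G 0 (-(κ * G.trace) / (2 * μ + κ))) =
      2 * μ * (frobSq (symPart G) + (κ / (2 * μ + κ)) * (G.trace) ^ 2) := by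
    rw [Q₃_blockMat μ κ h.ne']
    simp
  refine ⟨⟨⟨_, 0, hmin.symm⟩, ?_⟩, hmin⟩
  rintro x ⟨a, b, rfl⟩
  rw [Q₃_blockMat μ κ h.ne', add_assoc]
  exact le_add_of_nonneg_right (by positivity)
end

section
/- Let γ ≥ 0 and δ₀ ∈ ℝ. Define q(D) = |D|² + γ·(tr D)² − δ₀·(D · diag(1,0)) + ((2+γ)/3)·δ₀·tr D for 2×2 real symmetric matrices D. Then the minimum of q over all 2×2 real symmetric matrices equals −((5+γ)/36)·δ₀², and (when δ₀ ≠ 0) it is attained exactly at the matrix D = diag(δ₀/6, −δ₀/3). -/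
open Matrix Real

/-- Frobenius inner product `A · B = tr(Aᵀ B)`. -/
noncomputable def finner {ι : Type*} [Fintype ι] (A B : Matrix ι ι ℝ) : ℝ :=
  ∑ i, ∑ j, A i j * B i j

/-- The quadratic polynomial `q` of STATEMENT 3. -/
noncomputable def qSB (γ δ₀ : ℝ) (D : Matrix (Fin 2) (Fin 2) ℝ) : ℝ :=
  frobSq D + γ * (D.trace) ^ 2 - δ₀ * finner D (Matrix.diagonal ![1, 0])
    + (2 + γ) / 3 * δ₀ * D.trace

/-- Completing the square in `qSB` around its minimizer. -/
theorem qSB_eq_add_sq (γ δ₀ : ℝ) (D : Matrix (Fin 2) (Fin 2) ℝ) :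
    qSB γ δ₀ D = -((5 + γ) / 36) * δ₀ ^ 2 + ((D 0 0 - δ₀ / 6) ^ 2 + (D 1 1 + δ₀ / 3) ^ 2 +
      D 0 1 ^ 2 + D 1 0 ^ 2 + γ * (D 0 0 + D 1 1 + δ₀ / 6) ^ 2) := by
  simp [qSB, frobSq, finner, Matrix.trace, Fin.sum_univ_two]
  ring

/-- The value of `qSB` at its minimizer. -/
theorem qSB_diagonal (γ δ₀ : ℝ) :
    qSB γ δ₀ (Matrix.diagonal ![δ₀ / 6, -δ₀ / 3]) = -((5 + γ) / 36) * δ₀ ^ 2 := by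
  rw [qSB_eq_add_sq]
  simp
  ring

/-- the minimum of `q` over 2×2 real symmetric matrices is
`−((5+γ)/36) δ₀²`, attained (for `δ₀ ≠ 0`, exactly) at `D = diag(δ₀/6, −δ₀/3)`. -/
theorem stmt3 (γ δ₀ : ℝ) (hγ : 0 ≤ γ) :
    IsLeast {x : ℝ | ∃ D : Matrix (Fin 2) (Fin 2) ℝ, D.IsSymm ∧ x = qSB γ δ₀ D}
      (-((5 + γ) / 36) * δ₀ ^ 2) ∧
    (δ₀ ≠ 0 → ∀ D : Matrix (Fin 2) (Fin 2) ℝ, D.IsSymm →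
      (qSB γ δ₀ D = -((5 + γ) / 36) * δ₀ ^ 2 ↔
        D = Matrix.diagonal ![δ₀ / 6, -δ₀ / 3])) := by
  refine ⟨⟨⟨_, Matrix.isSymm_diagonal _, (qSB_diagonal γ δ₀).symm⟩, ?_⟩, ?_⟩
  · rintro _ ⟨D, -, rfl⟩
    rw [qSB_eq_add_sq]
    exact le_add_of_nonneg_right (by positivity)
  · refine fun _ D _ => ⟨fun h => ?_, fun h => h ▸ qSB_diagonal γ δ₀⟩
    rw [qSB_eq_add_sq] at h
    have hγt : 0 ≤ γ * (D 0 0 + D 1 1 + δ₀ / 6) ^ 2 := by positivity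
    have h00 : D 0 0 - δ₀ / 6 = 0 := by
      apply pow_eq_zero_iff two_ne_zero |>.mp
      nlinarith [sq_nonneg (D 0 0 - δ₀ / 6), sq_nonneg (D 1 1 + δ₀ / 3),
        sq_nonneg (D 0 1), sq_nonneg (D 1 0)]
    have h11 : D 1 1 + δ₀ / 3 = 0 := by
      apply pow_eq_zero_iff two_ne_zero |>.mp
      nlinarith [sq_nonneg (D 0 0 - δ₀ / 6), sq_nonneg (D 1 1 + δ₀ / 3),
        sq_nonneg (D 0 1), sq_nonneg (D 1 0)]
    have h01 : D 0 1 = 0 := by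
      apply pow_eq_zero_iff two_ne_zero |>.mp
      nlinarith [sq_nonneg (D 0 0 - δ₀ / 6), sq_nonneg (D 1 1 + δ₀ / 3),
        sq_nonneg (D 0 1), sq_nonneg (D 1 0)]
    have h10 : D 1 0 = 0 := by
      apply pow_eq_zero_iff two_ne_zero |>.mp
      nlinarith [sq_nonneg (D 0 0 - δ₀ / 6), sq_nonneg (D 1 1 + δ₀ / 3),
        sq_nonneg (D 0 1), sq_nonneg (D 1 0)]
    ext i j
    fin_cases i <;> fin_cases j <;> simp <;> linarith
end

section
/- Let γ ≥ 0 and δ₀ ∈ ℝ. Let M be the 2×2 symmetric matrix with both diagonal entries equal to 1 and both off-diagonal entries equal to 2/π. Define q(D) = |D|² + γ·(tr D)² − δ₀·( D · M − (2/3)(1−γ)·tr D ) for 2×2 real symmetric matrices D. Then the minimum of q over all 2×2 real symmetric matrices equals −((1+2γ)/18 + 2/π²)·δ₀², and (when δ₀ ≠ 0) it is attained exactly at the matrix D* with diagonal entries δ₀/6 and off-diagonal entries δ₀/π. -/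
open Matrix Real

/-- The quadratic polynomial `q` of STATEMENT 4, where `M = !![1, 2/π; 2/π, 1]`. -/
noncomputable def qT (γ δ₀ : ℝ) (D : Matrix (Fin 2) (Fin 2) ℝ) : ℝ :=
  frobSq D + γ * (D.trace) ^ 2
    - δ₀ * (finner D !![(1 : ℝ), 2 / π; 2 / π, 1] - (2 / 3) * (1 - γ) * D.trace)

/-- Completing the square in `qT` around its minimizer. -/
theorem qT_eq_add_sq (γ δ₀ : ℝ) {D : Matrix (Fin 2) (Fin 2) ℝ} (hD : D.IsSymm) :
    qT γ δ₀ D = -((1 + 2 * γ) / 18 + 2 / π ^ 2) * δ₀ ^ 2 +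
      ((D 0 0 - δ₀ / 6) ^ 2 + (D 1 1 - δ₀ / 6) ^ 2 + 2 * (D 0 1 - δ₀ / π) ^ 2 +
        γ * (D 0 0 + D 1 1 - δ₀ / 3) ^ 2) := by
  have h : D 1 0 = D 0 1 := hD.apply 0 1
  simp only [qT, frobSq, finner, Matrix.trace_fin_two, Fin.sum_univ_two, h, Matrix.of_apply,
    Matrix.cons_val_zero, Matrix.cons_val_one]
  ring

/-- the minimum of `q` over 2×2 real symmetric matrices is
`−((1+2γ)/18 + 2/π²) δ₀²`, attained (for `δ₀ ≠ 0`, exactly) at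
`D* = !![δ₀/6, δ₀/π; δ₀/π, δ₀/6]`. -/
theorem stmt4 (γ δ₀ : ℝ) (hγ : 0 ≤ γ) :
    IsLeast {x : ℝ | ∃ D : Matrix (Fin 2) (Fin 2) ℝ, D.IsSymm ∧ x = qT γ δ₀ D}
      (-((1 + 2 * γ) / 18 + 2 / π ^ 2) * δ₀ ^ 2) ∧
    (δ₀ ≠ 0 → ∀ D : Matrix (Fin 2) (Fin 2) ℝ, D.IsSymm →
      (qT γ δ₀ D = -((1 + 2 * γ) / 18 + 2 / π ^ 2) * δ₀ ^ 2 ↔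
        D = !![δ₀ / 6, δ₀ / π; δ₀ / π, δ₀ / 6])) := by
  have hsymm : (!![δ₀ / 6, δ₀ / π; δ₀ / π, δ₀ / 6] : Matrix (Fin 2) (Fin 2) ℝ).IsSymm := by
    ext i j
    fin_cases i <;> fin_cases j <;> rfl
  have hmin : qT γ δ₀ !![δ₀ / 6, δ₀ / π; δ₀ / π, δ₀ / 6] =
      -((1 + 2 * γ) / 18 + 2 / π ^ 2) * δ₀ ^ 2 := by
    rw [qT_eq_add_sq γ δ₀ hsymm]
    simp only [Matrix.of_apply, Matrix.cons_val_zero, Matrix.cons_val_one]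
    ring
  refine ⟨⟨⟨_, hsymm, hmin.symm⟩, ?_⟩, fun _ D hD => ⟨fun h => ?_, fun h => h ▸ hmin⟩⟩
  · rintro x ⟨D, hD, rfl⟩
    rw [qT_eq_add_sq γ δ₀ hD]
    exact le_add_of_nonneg_right (by positivity)
  · rw [qT_eq_add_sq γ δ₀ hD] at h
    have hsum := add_eq_left.mp h
    have hγsq : 0 ≤ γ * (D 0 0 + D 1 1 - δ₀ / 3) ^ 2 := by positivity
    have h00 : D 0 0 - δ₀ / 6 = 0 := by
      refine pow_eq_zero_iff two_ne_zero |>.mp ?_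
      linarith [sq_nonneg (D 0 0 - δ₀ / 6), sq_nonneg (D 1 1 - δ₀ / 6), sq_nonneg (D 0 1 - δ₀ / π)]
    have h11 : D 1 1 - δ₀ / 6 = 0 := by
      refine pow_eq_zero_iff two_ne_zero |>.mp ?_
      linarith [sq_nonneg (D 0 0 - δ₀ / 6), sq_nonneg (D 1 1 - δ₀ / 6), sq_nonneg (D 0 1 - δ₀ / π)]
    have h01 : D 0 1 - δ₀ / π = 0 := by
      refine pow_eq_zero_iff two_ne_zero |>.mp ?_
      linarith [sq_nonneg (D 0 0 - δ₀ / 6), sq_nonneg (D 1 1 - δ₀ / 6), sq_nonneg (D 0 1 - δ₀ / π)]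
    rw [D.eta_fin_two, hD.apply 0 1, sub_eq_zero.mp h00, sub_eq_zero.mp h11, sub_eq_zero.mp h01]
end

section
/- Let μ > 0, γ ≥ 0, δ₀ ∈ ℝ, and define Q₂(G) = 2μ·(|sym G|² + γ·(tr G)²) for G ∈ ℝ^{2×2}. Define B̌_SB(t) = −δ₀·( diag(cos²(π/4 + πt/2), 0) − I₂/3 ) for t ∈ (−1/2, 1/2). Then for every G ∈ ℝ^{2×2}, the infimum over all D ∈ ℝ^{2×2} of ∫_{−1/2}^{1/2} Q₂(D + t·G + B̌_SB(t)) dt is attained and equals 2μ·[ (1/12)·(|sym G|² + γ·(tr G)²) + (2δ₀/π²)·( (sym G)·diag(1,0) + γ·tr G ) + ((1+γ)/8)·δ₀² ]. -/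
open Matrix Real MeasureTheory

/-- The 2D quadratic form `Q₂(G) = 2μ (|sym G|² + γ (tr G)²)`. -/
noncomputable def Q₂ (μ γ : ℝ) (G : Matrix (Fin 2) (Fin 2) ℝ) : ℝ :=
  2 * μ * (frobSq (symPart G) + γ * (G.trace) ^ 2)

/-- The splay-bend matrix `B̌_SB(t) = −δ₀ (diag(cos²(π/4+πt/2), 0) − I₂/3)`. -/
noncomputable def BSB (δ₀ t : ℝ) : Matrix (Fin 2) (Fin 2) ℝ :=
  (-δ₀) • (Matrix.diagonal ![Real.cos (π / 4 + π * t / 2) ^ 2, 0]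
    - (1 / 3 : ℝ) • (1 : Matrix (Fin 2) (Fin 2) ℝ))

/-- Integral over `(-1/2, 1/2)` of a quadratic polynomial in `t` and `sin (π t)`. -/
theorem integral_quadratic_sin_pi (a b c d e f : ℝ) :
    ∫ t in Set.Ioo (-(1 : ℝ)/2) (1/2), (a + b * t + c * sin (π * t) + d * t ^ 2
        + e * (t * sin (π * t)) + f * sin (π * t) ^ 2)
      = a + d / 12 + 2 * e / π ^ 2 + f / 2 := by
  have hπ : π ≠ 0 := pi_ne_zero
  rw [← integral_Ioc_eq_integral_Ioo, ← intervalIntegral.integral_of_le (by norm_num)]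
  have hderiv (t : ℝ) : HasDerivAt (fun t : ℝ => a * t + b * (t ^ 2 / 2) - c * (cos (π * t) / π)
      + d * (t ^ 3 / 3) + e * (sin (π * t) / π ^ 2 - t * cos (π * t) / π)
      + f * (t / 2 - sin (π * t) * cos (π * t) / (2 * π)))
      (a + b * t + c * sin (π * t) + d * t ^ 2
        + e * (t * sin (π * t)) + f * sin (π * t) ^ 2) t := by
    have hid := hasDerivAt_id' t
    have hlin : HasDerivAt (fun t : ℝ => π * t) π t := by simpa using hid.const_mul π
    have hsin := hlin.sin
    have hcos := hlin.cos
    refine HasDerivAt.congr_deriv ((((((hid.const_mul a).add (((hid.pow 2).div_const 2).const_mul b)).sub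
      ((hcos.div_const π).const_mul c)).add (((hid.pow 3).div_const 3).const_mul d)).add
      (((hsin.div_const (π ^ 2)).sub ((hid.mul hcos).div_const π)).const_mul e)).add
      (((hid.div_const 2).sub ((hsin.mul hcos).div_const (2 * π))).const_mul f)) ?_
    push_cast
    field_simp
    ring_nf
    simp only [cos_sq']
    ring
  rw [intervalIntegral.integral_eq_sub_of_hasDerivAt (fun t _ => hderiv t)
    (Continuous.intervalIntegrable (by fun_prop) _ _)]
  have hr : π * (1 / 2) = π / 2 := by ring
  have hl : π * (-1 / 2) = -(π / 2) := by ring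
  simp only [hr, hl, sin_neg, cos_neg, sin_pi_div_two, cos_pi_div_two]
  field_simp
  ring

theorem cos_sq_pi_div_four_add (t : ℝ) :
    cos (π / 4 + π * t / 2) ^ 2 = (1 - sin (π * t)) / 2 := by
  rw [cos_sq, show 2 * (π / 4 + π * t / 2) = π * t + π / 2 by ring, cos_add_pi_div_two]
  ring

/-- The bending energy splits into its value at the optimal `D` and a quadratic form in the
deviation of `D` from the optimum. -/
theorem integral_Q₂_BSB (μ γ δ₀ : ℝ) (G D : Matrix (Fin 2) (Fin 2) ℝ) :
    ∫ t in Set.Ioo (-(1 : ℝ)/2) (1/2), Q₂ μ γ (D + t • G + BSB δ₀ t)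
      = 2 * μ * ((1 / 12) * (frobSq (symPart G) + γ * (G.trace) ^ 2)
        + (2 * δ₀ / π ^ 2) * (finner (symPart G) (Matrix.diagonal ![1, 0]) + γ * G.trace)
        + ((1 + γ) / 8) * δ₀ ^ 2)
        + Q₂ μ γ (D - Matrix.diagonal ![δ₀ / 6, -δ₀ / 3]) := by
  set p := D 0 0 - δ₀ / 6 with hp
  set q := D 1 1 + δ₀ / 3 with hq
  set r := (D 0 1 + D 1 0) / 2 with hr
  set g := (G 0 1 + G 1 0) / 2 with hg
  have hexp (t : ℝ) : Q₂ μ γ (D + t • G + BSB δ₀ t)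
      = 2 * μ * (p ^ 2 + q ^ 2 + 2 * r ^ 2 + γ * (p + q) ^ 2)
        + 4 * μ * (p * G 0 0 + q * G 1 1 + 2 * r * g + γ * (p + q) * (G 0 0 + G 1 1)) * t
        + 2 * μ * δ₀ * (p + γ * (p + q)) * sin (π * t)
        + 2 * μ * (G 0 0 ^ 2 + G 1 1 ^ 2 + 2 * g ^ 2 + γ * (G 0 0 + G 1 1) ^ 2) * t ^ 2
        + 2 * μ * δ₀ * (G 0 0 + γ * (G 0 0 + G 1 1)) * (t * sin (π * t))
        + μ * (1 + γ) * δ₀ ^ 2 / 2 * sin (π * t) ^ 2 := by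
    simp [Q₂, BSB, frobSq, symPart, Matrix.trace, Fin.sum_univ_two, cos_sq_pi_div_four_add,
      hp, hq, hr, hg]
    ring
  simp only [hexp, integral_quadratic_sin_pi]
  simp [Q₂, frobSq, symPart, finner, Matrix.trace, Fin.sum_univ_two, hp, hq, hr, hg]
  ring

theorem Q₂_nonneg {μ γ : ℝ} (hμ : 0 ≤ μ) (hγ : 0 ≤ γ) (G : Matrix (Fin 2) (Fin 2) ℝ) :
    0 ≤ Q₂ μ γ G := by
  unfold Q₂ frobSq
  positivity

/-- the infimum over `D` of `∫_{−1/2}^{1/2} Q₂(D + t G + B̌_SB(t)) dt` is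
attained and equals
`2μ [ (1/12)(|sym G|² + γ tr²G) + (2δ₀/π²)((sym G)·diag(1,0) + γ tr G) + ((1+γ)/8) δ₀² ]`. -/
theorem stmt5 (μ γ δ₀ : ℝ) (hμ : 0 < μ) (hγ : 0 ≤ γ) (G : Matrix (Fin 2) (Fin 2) ℝ) :
    IsLeast {x : ℝ | ∃ D : Matrix (Fin 2) (Fin 2) ℝ,
        x = ∫ t in Set.Ioo (-(1 : ℝ)/2) (1/2), Q₂ μ γ (D + t • G + BSB δ₀ t)}
      (2 * μ * ((1 / 12) * (frobSq (symPart G) + γ * (G.trace) ^ 2)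
        + (2 * δ₀ / π ^ 2) * (finner (symPart G) (Matrix.diagonal ![1, 0]) + γ * G.trace)
        + ((1 + γ) / 8) * δ₀ ^ 2)) := by
  refine ⟨⟨Matrix.diagonal ![δ₀ / 6, -δ₀ / 3], ?_⟩, ?_⟩
  · rw [integral_Q₂_BSB, sub_self]
    simp [Q₂, frobSq, symPart]
  · rintro x ⟨D, rfl⟩
    rw [integral_Q₂_BSB]
    exact le_add_of_nonneg_right (Q₂_nonneg hμ.le hγ _)
end

section
/- Let μ > 0, γ ≥ 0, δ₀ ∈ ℝ, and define Q₂(G) = 2μ·(|sym G|² + γ·(tr G)²) for G ∈ ℝ^{2×2}. Let θ(t) = π/4 + πt/2, let M̌_T(t) be the 2×2 symmetric matrix with entries M̌_T(t)₁₁ = cos²θ(t), M̌_T(t)₂₂ = sin²θ(t), M̌_T(t)₁₂ = M̌_T(t)₂₁ = sin θ(t)·cos θ(t), and define B̌_T(t) = −δ₀·( M̌_T(t) − I₂/3 ). Then for every G ∈ ℝ^{2×2}, the infimum over all D ∈ ℝ^{2×2} of ∫_{−1/2}^{1/2} Q₂(D + t·G + B̌_T(t)) dt is attained and equals 2μ·[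 (1/12)·(|sym G|² + γ·(tr G)²) + (2δ₀/π²)·( (sym G)·diag(1,−1) ) + (1/2 − 2/π²)·δ₀² ]. -/
open Matrix Real MeasureTheory

/-- The twisted texture matrix `M̌_T(t)` with `θ(t) = π/4 + πt/2`. -/
noncomputable def MT (t : ℝ) : Matrix (Fin 2) (Fin 2) ℝ :=
  !![Real.cos (π / 4 + π * t / 2) ^ 2,
      Real.sin (π / 4 + π * t / 2) * Real.cos (π / 4 + π * t / 2);
    Real.sin (π / 4 + π * t / 2) * Real.cos (π / 4 + π * t / 2),
      Real.sin (π / 4 + π * t / 2) ^ 2]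

/-- The twisted matrix `B̌_T(t) = −δ₀ (M̌_T(t) − I₂/3)`. -/
noncomputable def BT (δ₀ t : ℝ) : Matrix (Fin 2) (Fin 2) ℝ :=
  (-δ₀) • (MT t - (1 / 3 : ℝ) • (1 : Matrix (Fin 2) (Fin 2) ℝ))

/-- Integral over `(-1/2, 1/2)` of an affine combination of the functions
`t, t², sin πt, cos πt, t sin πt, t cos πt`. -/
lemma integral_trig_poly (k₀ k₁ k₂ kₛ kc m n : ℝ) :
    ∫ t in Set.Ioo (-(1 : ℝ)/2) (1/2), (k₀ + k₁ * t + k₂ * t ^ 2 + kₛ * Real.sin (π * t)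
      + kc * Real.cos (π * t) + m * (t * Real.sin (π * t)) + n * (t * Real.cos (π * t)))
      = k₀ + k₂ / 12 + kc * (2 / π) + m * (2 / π ^ 2) := by
  have hπ : π ≠ 0 := Real.pi_ne_zero
  rw [← integral_Ioc_eq_integral_Ioo, ← intervalIntegral.integral_of_le (by norm_num)]
  have hderiv : ∀ t ∈ Set.uIcc (-(1 : ℝ)/2) (1/2), HasDerivAt
      (fun t : ℝ => k₀ * t + k₁ * (t ^ 2 / 2) + k₂ * (t ^ 3 / 3) + kₛ * (-Real.cos (π * t) / π)
        + kc * (Real.sin (π * t) / π)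
        + m * (-(t * Real.cos (π * t)) / π + Real.sin (π * t) / π ^ 2)
        + n * ((t * Real.sin (π * t)) / π + Real.cos (π * t) / π ^ 2))
      (k₀ + k₁ * t + k₂ * t ^ 2 + kₛ * Real.sin (π * t)
        + kc * Real.cos (π * t) + m * (t * Real.sin (π * t)) + n * (t * Real.cos (π * t))) t := by
    intro t _
    have hid := hasDerivAt_id' t
    have hlin : HasDerivAt (fun t : ℝ => π * t) (π * 1) t := hid.const_mul π
    have hs := hlin.sin
    have hc := hlin.cos
    have h := ((((((hid.const_mul k₀).add (((hid.pow 2).div_const 2).const_mul k₁)).add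
      (((hid.pow 3).div_const 3).const_mul k₂)).add ((hc.neg.div_const π).const_mul kₛ)).add
      ((hs.div_const π).const_mul kc)).add
      ((((hid.mul hc).neg.div_const π).add (hs.div_const (π ^ 2))).const_mul m)).add
      ((((hid.mul hs).div_const π).add (hc.div_const (π ^ 2))).const_mul n)
    refine HasDerivAt.congr_deriv h ?_
    field_simp
    push_cast
    ring
  rw [intervalIntegral.integral_eq_sub_of_hasDerivAt hderiv
    (Continuous.intervalIntegrable (by fun_prop) _ _)]
  have e₁ : π * (1 / 2) = π / 2 := by ring
  have e₂ : π * (-1 / 2) = -(π / 2) := by ring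
  simp only [e₁, e₂, Real.sin_neg, Real.cos_neg, Real.sin_pi_div_two, Real.cos_pi_div_two]
  field_simp
  ring

lemma MT_eq (t : ℝ) :
    MT t = !![(1 - Real.sin (π * t)) / 2, Real.cos (π * t) / 2;
      Real.cos (π * t) / 2, (1 + Real.sin (π * t)) / 2] := by
  have hangle : 2 * (π / 4 + π * t / 2) = π * t + π / 2 := by ring
  have hc := Real.cos_two_mul (π / 4 + π * t / 2)
  have hs := Real.sin_two_mul (π / 4 + π * t / 2)
  have hsq := Real.sin_sq_add_cos_sq (π / 4 + π * t / 2)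
  rw [hangle, Real.cos_add_pi_div_two] at hc
  rw [hangle, Real.sin_add_pi_div_two] at hs
  ext i j
  fin_cases i <;> fin_cases j <;> simp [MT] <;> linarith

/-- The energy of `D` in closed form, up to the minimal value a sum of squares in `D`. -/
lemma integral_Q₂_eq (μ γ δ₀ : ℝ) (D G : Matrix (Fin 2) (Fin 2) ℝ) :
    ∫ t in Set.Ioo (-(1 : ℝ)/2) (1/2), Q₂ μ γ (D + t • G + BT δ₀ t) =
      2 * μ * ((1 / 12) * (frobSq (symPart G) + γ * (G.trace) ^ 2)
        + (2 * δ₀ / π ^ 2) * finner (symPart G) (Matrix.diagonal ![1, -1])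
        + (1 / 2 - 2 / π ^ 2) * δ₀ ^ 2)
      + 2 * μ * ((D 0 0 - δ₀ / 6) ^ 2 + (D 1 1 - δ₀ / 6) ^ 2
        + 2 * ((D 0 1 + D 1 0) / 2 - δ₀ / π) ^ 2
        + γ * (D 0 0 + D 1 1 - δ₀ / 3) ^ 2) := by
  have hexp : ∀ t : ℝ, Q₂ μ γ (D + t • G + BT δ₀ t) = 2 * μ * (
      ((D 0 0 - δ₀ / 6) ^ 2 + (D 1 1 - δ₀ / 6) ^ 2 + 2 * ((D 0 1 + D 1 0) / 2) ^ 2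
        + δ₀ ^ 2 / 2 + γ * (D 0 0 + D 1 1 - δ₀ / 3) ^ 2)
      + (2 * (D 0 0 - δ₀ / 6) * G 0 0 + 2 * (D 1 1 - δ₀ / 6) * G 1 1
        + (D 0 1 + D 1 0) * (G 0 1 + G 1 0)
        + 2 * γ * (D 0 0 + D 1 1 - δ₀ / 3) * (G 0 0 + G 1 1)) * t
      + (G 0 0 ^ 2 + G 1 1 ^ 2 + 2 * ((G 0 1 + G 1 0) / 2) ^ 2
        + γ * (G 0 0 + G 1 1) ^ 2) * t ^ 2
      + δ₀ * (D 0 0 - D 1 1) * Real.sin (π * t)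
      + (-δ₀ * (D 0 1 + D 1 0)) * Real.cos (π * t)
      + δ₀ * (G 0 0 - G 1 1) * (t * Real.sin (π * t))
      + (-δ₀ * (G 0 1 + G 1 0)) * (t * Real.cos (π * t))) := by
    intro t
    simp only [Q₂, frobSq, symPart, BT, MT_eq, Matrix.trace, Matrix.diag, Fin.sum_univ_two,
      Matrix.add_apply, Matrix.sub_apply, Matrix.smul_apply, Matrix.transpose_apply,
      Matrix.of_apply, Matrix.cons_val', Matrix.cons_val_zero, Matrix.cons_val_one,
      Matrix.cons_val_fin_one, Matrix.one_apply, smul_eq_mul, Fin.isValue, if_true,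
      zero_ne_one, one_ne_zero, if_false]
    linear_combination (μ * δ₀ ^ 2) * Real.sin_sq_add_cos_sq (π * t)
  simp only [hexp]
  rw [integral_const_mul, integral_trig_poly]
  simp [frobSq, symPart, finner, Matrix.trace, Fin.sum_univ_two]
  field_simp
  ring

/-- the infimum over `D` of `∫_{−1/2}^{1/2} Q₂(D + t G + B̌_T(t)) dt` is
attained and equals
`2μ [ (1/12)(|sym G|² + γ tr²G) + (2δ₀/π²)((sym G)·diag(1,−1)) + (1/2 − 2/π²) δ₀² ]`. -/
theorem stmt7 (μ γ δ₀ : ℝ) (hμ : 0 < μ) (hγ : 0 ≤ γ) (G : Matrix (Fin 2) (Fin 2) ℝ) :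
    IsLeast {x : ℝ | ∃ D : Matrix (Fin 2) (Fin 2) ℝ,
        x = ∫ t in Set.Ioo (-(1 : ℝ)/2) (1/2), Q₂ μ γ (D + t • G + BT δ₀ t)}
      (2 * μ * ((1 / 12) * (frobSq (symPart G) + γ * (G.trace) ^ 2)
        + (2 * δ₀ / π ^ 2) * finner (symPart G) (Matrix.diagonal ![1, -1])
        + (1 / 2 - 2 / π ^ 2) * δ₀ ^ 2)) := by
  refine ⟨⟨!![δ₀ / 6, δ₀ / π; δ₀ / π, δ₀ / 6], ?_⟩, ?_⟩
  · rw [integral_Q₂_eq]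
    simp
    ring_nf
    simp
  · rintro x ⟨D, rfl⟩
    rw [integral_Q₂_eq]
    exact le_add_of_nonneg_right (by positivity)
end

section
/- Let μ > 0, γ ≥ 0, δ₀ ∈ ℝ, and define Q₂(G) = 2μ·(|sym G|² + γ·(tr G)²) for G ∈ ℝ^{2×2}. With θ(t) = π/4 + πt/2, let M̌_T(t) be the 2×2 symmetric matrix with diagonal entries cos²θ(t), sin²θ(t) and off-diagonal entries sin θ(t)·cos θ(t), let B̌_T(t) = −δ₀·( M̌_T(t) − I₂/3 ), and for G ∈ ℝ^{2×2} set Q̄_T(G) = inf over D ∈ ℝ^{2×2} of ∫_{−1/2}^{1/2} Q₂(D + t·G + B̌_T(t)) dt. Let Ā_T = (12δ₀/π²)·diag(−1, 1) and β_T = μ·δ₀²·(π⁴ − 4π² − 48)/π⁴. Then for every symmetric G ∈ ℝ^{2×2}, Q̄_T(G) = (1/12)·Q₂(G − Ā_T) + β_T; in particular Q̄_T(G) − (1/12)·Q₂(G − Ā_T) is a constant independent of G, and this constant is strictly positive when δ₀ ≠ 0. -/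
open Matrix Real MeasureTheory

/-- `Q̄_T(G) = inf_D ∫_{−1/2}^{1/2} Q₂(D + t G + B̌_T(t)) dt`. -/
noncomputable def QbarT (μ γ δ₀ : ℝ) (G : Matrix (Fin 2) (Fin 2) ℝ) : ℝ :=
  sInf {x : ℝ | ∃ D : Matrix (Fin 2) (Fin 2) ℝ,
    x = ∫ t in Set.Ioo (-(1 : ℝ)/2) (1/2), Q₂ μ γ (D + t • G + BT δ₀ t)}

/-- The twisted target curvature `Ā_T = (12δ₀/π²) diag(−1,1)`. -/
noncomputable def AT (δ₀ : ℝ) : Matrix (Fin 2) (Fin 2) ℝ :=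
  (12 * δ₀ / π ^ 2) • Matrix.diagonal ![-1, 1]

/-- The constant `β_T = μ δ₀² (π⁴ − 4π² − 48)/π⁴`. -/
noncomputable def βT (μ δ₀ : ℝ) : ℝ :=
  μ * δ₀ ^ 2 * (π ^ 4 - 4 * π ^ 2 - 48) / π ^ 4

/-- Pointwise form of the integrand, with `θ` eliminated by the double-angle formulas. -/
lemma Q₂_add_smul_add_BT (μ γ δ₀ t : ℝ) (D G : Matrix (Fin 2) (Fin 2) ℝ) (hG : G.IsSymm) :
    Q₂ μ γ (D + t • G + BT δ₀ t) = 2 * μ *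
      ((D 0 0 - δ₀ / 6 + t * G 0 0 + δ₀ / 2 * sin (π * t) + 0 * cos (π * t)) ^ 2 +
        (D 1 1 - δ₀ / 6 + t * G 1 1 + -(δ₀ / 2) * sin (π * t) + 0 * cos (π * t)) ^ 2 +
        2 * ((D 0 1 + D 1 0) / 2 + t * G 0 1 + 0 * sin (π * t) + -(δ₀ / 2) * cos (π * t)) ^ 2 +
        γ * (D 0 0 + D 1 1 - δ₀ / 3 + t * (G 0 0 + G 1 1) + 0 * sin (π * t) +
          0 * cos (π * t)) ^ 2) := by
  have hsym : G 1 0 = G 0 1 := hG.apply 0 1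
  set θ := π / 4 + π * t / 2 with hθ
  have h2θ : π * t = 2 * θ - π / 2 := by rw [hθ]; ring
  have hs : sin (π * t) = 1 - 2 * cos θ ^ 2 := by
    rw [h2θ, sin_sub_pi_div_two, cos_two_mul]; ring
  have hc : cos (π * t) = 2 * sin θ * cos θ := by
    rw [h2θ, cos_sub_pi_div_two, sin_two_mul]
  rw [hs, hc]
  simp [Q₂, frobSq, symPart, BT, MT, Matrix.trace, Fin.sum_univ_two, ← hθ, hsym, sin_sq, -mul_eq_mul_left_iff]
  ring

/-- The elementary integral behind the relaxation over `D`. -/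
lemma integral_sq_affine_add_trig (a g k l : ℝ) :
    ∫ t in (-(1 : ℝ) / 2)..(1 / 2), (a + t * g + k * sin (π * t) + l * cos (π * t)) ^ 2 =
      a ^ 2 + g ^ 2 / 12 + (k ^ 2 + l ^ 2) / 2 + 4 * g * k / π ^ 2 + 4 * a * l / π := by
  have hπ := pi_ne_zero
  have hderiv (t : ℝ) : HasDerivAt (fun t : ℝ => a ^ 2 * t + a * g * t ^ 2 + g ^ 2 * t ^ 3 / 3 +
      2 * a * (k * (-cos (π * t)) + l * sin (π * t)) / π +
      2 * g * k * (sin (π * t) / π ^ 2 - t * cos (π * t) / π) +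
      2 * g * l * (cos (π * t) / π ^ 2 + t * sin (π * t) / π) +
      k ^ 2 * (t / 2 - sin (π * t) * cos (π * t) / (2 * π)) +
      l ^ 2 * (t / 2 + sin (π * t) * cos (π * t) / (2 * π)) + k * l * sin (π * t) ^ 2 / π)
      ((a + t * g + k * sin (π * t) + l * cos (π * t)) ^ 2) t := by
    have hid := hasDerivAt_id' t
    have hs := (hid.const_mul π).sin
    have hc := (hid.const_mul π).cos
    have hsc := (hs.mul hc).div_const (2 * π)
    refine (((((((((hid.const_mul (a ^ 2)).add ((hid.pow 2).const_mul (a * g))).add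
      (((hid.pow 3).const_mul (g ^ 2)).div_const 3)).add
      ((((hc.neg.const_mul k).add (hs.const_mul l)).const_mul (2 * a)).div_const π)).add
      (((hs.div_const (π ^ 2)).sub ((hid.mul hc).div_const π)).const_mul (2 * g * k))).add
      (((hc.div_const (π ^ 2)).add ((hid.mul hs).div_const π)).const_mul (2 * g * l))).add
      (((hid.div_const 2).sub hsc).const_mul (k ^ 2))).add
      (((hid.div_const 2).add hsc).const_mul (l ^ 2))).add
      (((hs.pow 2).const_mul (k * l)).div_const π)).congr_deriv ?_
    field_simp
    simp
    ring_nf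
    simp only [sin_sq]
    ring
  rw [intervalIntegral.integral_eq_sub_of_hasDerivAt (fun t _ => hderiv t)
    (Continuous.intervalIntegrable (by fun_prop) _ _)]
  have h₁ : π * (1 / 2) = π / 2 := by ring
  have h₂ : π * (-1 / 2) = -(π / 2) := by ring
  simp only [h₁, h₂, sin_neg, cos_neg, sin_pi_div_two, cos_pi_div_two]
  field_simp
  ring

/-- Completing the square in `D`. -/
lemma integral_Q₂_add_smul_add_BT (μ γ δ₀ : ℝ) (D G : Matrix (Fin 2) (Fin 2) ℝ)
    (hG : G.IsSymm) :
    ∫ t in Set.Ioo (-(1 : ℝ) / 2) (1 / 2), Q₂ μ γ (D + t • G + BT δ₀ t) =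
      (1 / 12) * Q₂ μ γ (G - AT δ₀) + βT μ δ₀ + 2 * μ *
        ((D 0 0 - δ₀ / 6) ^ 2 + (D 1 1 - δ₀ / 6) ^ 2 + 2 * ((D 0 1 + D 1 0) / 2 - δ₀ / π) ^ 2 +
          γ * (D 0 0 + D 1 1 - δ₀ / 3) ^ 2) := by
  have hsym : G 1 0 = G 0 1 := hG.apply 0 1
  have hπ := pi_ne_zero
  rw [← integral_Ioc_eq_integral_Ioo, ← intervalIntegral.integral_of_le (by norm_num)]
  simp only [Q₂_add_smul_add_BT μ γ δ₀ _ D G hG]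
  rw [intervalIntegral.integral_const_mul, intervalIntegral.integral_add,
    intervalIntegral.integral_add, intervalIntegral.integral_add,
    intervalIntegral.integral_const_mul, intervalIntegral.integral_const_mul]
  · simp only [integral_sq_affine_add_trig]
    simp [Q₂, frobSq, symPart, AT, βT, Matrix.trace, Fin.sum_univ_two, hsym]
    field_simp
    ring
  all_goals exact Continuous.intervalIntegrable (by fun_prop) _ _

lemma βT_pos {μ δ₀ : ℝ} (hμ : 0 < μ) (hδ : δ₀ ≠ 0) : 0 < βT μ δ₀ := by
  have hπ : 9.8 < π ^ 2 := by nlinarith [pi_gt_d2]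
  have hpoly : 0 < π ^ 4 - 4 * π ^ 2 - 48 := by nlinarith
  unfold βT
  positivity

/-- for every symmetric `G`, `Q̄_T(G) = (1/12) Q₂(G − Ā_T) + β_T`;
the constant `β_T` is independent of `G` and strictly positive when `δ₀ ≠ 0`. -/
theorem stmt8 (μ γ δ₀ : ℝ) (hμ : 0 < μ) (hγ : 0 ≤ γ) :
    (∀ G : Matrix (Fin 2) (Fin 2) ℝ, G.IsSymm →
      QbarT μ γ δ₀ G = (1 / 12) * Q₂ μ γ (G - AT δ₀) + βT μ δ₀) ∧
    (δ₀ ≠ 0 → 0 < βT μ δ₀) := by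
  refine ⟨fun G hG => IsLeast.csInf_eq ⟨⟨!![δ₀ / 6, δ₀ / π; δ₀ / π, δ₀ / 6], ?_⟩, ?_⟩, βT_pos hμ⟩
  · rw [integral_Q₂_add_smul_add_BT μ γ δ₀ _ G hG]
    simp [-mul_eq_zero]
    ring
  · rintro x ⟨D, rfl⟩
    rw [integral_Q₂_add_smul_add_BT μ γ δ₀ D G hG]
    exact le_add_of_nonneg_right (by positivity)
end

section
/- Let γ ≥ 0 and α ∈ ℝ with α ≠ 0. Then the minimum over all 2×2 real symmetric matrices A with det A = 0 of |A − diag(α, −α)|² + γ·(tr A)² equals α²·(1+2γ)/(1+γ), and this minimum is attained exactly at the two matrices A⁺ = diag(α/(1+γ), 0) and A⁻ = diag(0, −α/(1+γ)). -/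
open Matrix Real

/-- Completing the square in the difference of the diagonal entries. -/
theorem frobSq_sub_diagonal_add_trace_sq (γ α : ℝ) (hγ : 1 + γ ≠ 0)
    (A : Matrix (Fin 2) (Fin 2) ℝ) (hA : A.IsSymm) (hdet : A.det = 0) :
    frobSq (A - Matrix.diagonal ![α, -α]) + γ * A.trace ^ 2 =
      α ^ 2 * (1 + 2 * γ) / (1 + γ) +
        (1 + γ) * ((A 0 0 - A 1 1 - α / (1 + γ)) ^ 2 + (2 * A 0 1) ^ 2) := by
  have hsymm : A 1 0 = A 0 1 := hA.apply 0 1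
  rw [Matrix.det_fin_two, hsymm] at hdet
  simp only [frobSq, Fin.sum_univ_two, Matrix.trace_fin_two, Matrix.sub_apply,
    Matrix.diagonal_apply, hsymm]
  simp
  field_simp
  linear_combination (4 * γ ^ 2 + 6 * γ + 2) * hdet

/-- the minimum over 2×2 symmetric matrices `A` with `det A = 0` of
`|A − diag(α,−α)|² + γ (tr A)²` is `α² (1+2γ)/(1+γ)`, attained exactly at
`A⁺ = diag(α/(1+γ), 0)` and `A⁻ = diag(0, −α/(1+γ))`. -/
theorem stmt9 (γ α : ℝ) (hγ : 0 ≤ γ) (hα : α ≠ 0) :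
    IsLeast {x : ℝ | ∃ A : Matrix (Fin 2) (Fin 2) ℝ, A.IsSymm ∧ A.det = 0 ∧
        x = frobSq (A - Matrix.diagonal ![α, -α]) + γ * (A.trace) ^ 2}
      (α ^ 2 * (1 + 2 * γ) / (1 + γ)) ∧
    ∀ A : Matrix (Fin 2) (Fin 2) ℝ, A.IsSymm → A.det = 0 →
      (frobSq (A - Matrix.diagonal ![α, -α]) + γ * (A.trace) ^ 2
          = α ^ 2 * (1 + 2 * γ) / (1 + γ) ↔
        A = Matrix.diagonal ![α / (1 + γ), 0] ∨
        A = Matrix.diagonal ![0, -α / (1 + γ)]) := by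
  have hpos : 0 < 1 + γ := by linarith
  have key := frobSq_sub_diagonal_add_trace_sq γ α hpos.ne'
  refine ⟨⟨⟨Matrix.diagonal ![α / (1 + γ), 0], Matrix.isSymm_diagonal _, by simp, ?_⟩, ?_⟩, ?_⟩
  · rw [key _ (Matrix.isSymm_diagonal _) (by simp)]
    simp
  · rintro x ⟨A, hA, hdet, rfl⟩
    rw [key A hA hdet]
    exact le_add_of_nonneg_right (by positivity)
  · intro A hA hdet
    rw [key A hA hdet]
    constructor
    · intro h
      have hsum : (A 0 0 - A 1 1 - α / (1 + γ)) ^ 2 + (2 * A 0 1) ^ 2 = 0 :=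
        (mul_eq_zero.mp (add_eq_left.mp h)).resolve_left hpos.ne'
      have hd : A 0 0 - A 1 1 - α / (1 + γ) = 0 := by
        rw [← sq_eq_zero_iff]
        linarith [sq_nonneg (A 0 0 - A 1 1 - α / (1 + γ)), sq_nonneg (2 * A 0 1)]
      have hb : A 0 1 = 0 := by
        rw [hd] at hsum
        simpa using hsum
      have hb' : A 1 0 = 0 := (hA.apply 0 1).trans hb
      rw [Matrix.det_fin_two, hb, zero_mul, sub_zero, mul_eq_zero] at hdet
      rcases hdet with h0 | h1
      · right
        have h1 : A 1 1 = -α / (1 + γ) := by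
          rw [neg_div]
          linarith
        ext i j
        fin_cases i <;> fin_cases j <;> simp [h0, h1, hb, hb']
      · left
        have h0 : A 0 0 = α / (1 + γ) := by linarith
        ext i j
        fin_cases i <;> fin_cases j <;> simp [h0, h1, hb, hb']
    · rintro (rfl | rfl)
      · simp
      · simp [neg_div]
end

section
/- Let ω ⊆ ℝ² be a nonempty open set, h > 0, and Ω_h = ω × (−h/2, h/2) ⊆ ℝ³. Let a > 0 with a ≠ 1, and for z = (z₁, z₂, z₃) ∈ Ω_h define the unit vector n(z₃) = (cos(π/4 + (π/(2h))·z₃), 0, sin(π/4 + (π/(2h))·z₃)) and the positive definite symmetric matrix G(z₃) = I₃ + (a − 1)·n(z₃)⊗n(z₃). Then there exists no smooth (C^∞) map v : Ω_h → ℝ³ such that det Dv(z) > 0 and (Dv(z))ᵀ·Dv(z) = G(z₃) for every z ∈ Ω_h (splay-bend spontaneous strains are kinematically incompatible). -/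
open Matrix Real

/-- The Jacobian matrix of a map `v : ℝ³ → ℝ³` at a point. -/
noncomputable def Dmat (v : (Fin 3 → ℝ) → (Fin 3 → ℝ)) (z : Fin 3 → ℝ) :
    Matrix (Fin 3) (Fin 3) ℝ :=
  Matrix.of fun i j => fderiv ℝ v z (Pi.single j 1) i

/-- The splay-bend director `n(z₃) = (cos(π/4 + (π/(2h))z₃), 0, sin(π/4 + (π/(2h))z₃))`. -/
noncomputable def nSB (h t : ℝ) : Fin 3 → ℝ :=
  ![Real.cos (π / 4 + π / (2 * h) * t), 0, Real.sin (π / 4 + π / (2 * h) * t)]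

/-- The slab `Ω_h = ω × (−h/2, h/2)` inside `ℝ³`. -/
def slab (ω : Set (ℝ × ℝ)) (h : ℝ) : Set (Fin 3 → ℝ) :=
  {z | (z 0, z 1) ∈ ω ∧ z 2 ∈ Set.Ioo (-(h / 2)) (h / 2)}

/-- The partial derivative of `f` in the `j`-th coordinate direction. -/
noncomputable def partialDeriv {F : Type*} [NormedAddCommGroup F] [NormedSpace ℝ F]
    (j : Fin 3) (f : (Fin 3 → ℝ) → F) (z : Fin 3 → ℝ) : F :=
  fderiv ℝ f z (Pi.single j 1)

theorem ContDiffOn.partialDeriv {F : Type*} [NormedAddCommGroup F] [NormedSpace ℝ F]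
    {S : Set (Fin 3 → ℝ)} (hS : IsOpen S) {f : (Fin 3 → ℝ) → F}
    (hf : ContDiffOn ℝ (⊤ : ℕ∞) f S) (j : Fin 3) :
    ContDiffOn ℝ (⊤ : ℕ∞) (partialDeriv j f) S :=
  (hf.fderiv_of_isOpen hS (by simp)).clm_apply contDiffOn_const

theorem partialDeriv_comm {F : Type*} [NormedAddCommGroup F] [NormedSpace ℝ F]
    {S : Set (Fin 3 → ℝ)} (hS : IsOpen S) {f : (Fin 3 → ℝ) → F}
    (hf : ContDiffOn ℝ (⊤ : ℕ∞) f S) (i j : Fin 3) {z : Fin 3 → ℝ} (hz : z ∈ S) :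
    partialDeriv i (partialDeriv j f) z = partialDeriv j (partialDeriv i f) z := by
  have hd : DifferentiableAt ℝ (fderiv ℝ f) z :=
    ((hf.fderiv_of_isOpen (m := (⊤ : ℕ∞)) hS (by simp)).contDiffAt
      (hS.mem_nhds hz)).differentiableAt (by simp)
  have key (k l : Fin 3) : partialDeriv k (partialDeriv l f) z =
      fderiv ℝ (fderiv ℝ f) z (Pi.single k 1) (Pi.single l 1) := by
    have := (hd.hasFDerivAt.clm_apply
      (hasFDerivAt_const (Pi.single l 1 : Fin 3 → ℝ) z)).fderiv
    unfold partialDeriv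
    rw [this]
    simp
  rw [key, key]
  exact ((hf.contDiffAt (hS.mem_nhds hz)).isSymmSndFDerivAt
    (by
      rw [minSmoothness_of_isRCLikeNormedField]
      exact WithTop.coe_le_coe.2 (le_top : (2 : ℕ∞) ≤ ⊤))) _ _

/-- Differentiating an identity `f ⬝ g = φ(z₃)` on an open set. -/
theorem partialDeriv_dotProduct_eq {S : Set (Fin 3 → ℝ)} (hS : IsOpen S)
    {f g : (Fin 3 → ℝ) → Fin 3 → ℝ} (hf : ContDiffOn ℝ (⊤ : ℕ∞) f S)
    (hg : ContDiffOn ℝ (⊤ : ℕ∞) g S) {φ φ' : ℝ → ℝ} (hφ : ∀ t, HasDerivAt φ (φ' t) t)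
    (h : ∀ z ∈ S, f z ⬝ᵥ g z = φ (z 2)) (j : Fin 3) {z : Fin 3 → ℝ} (hz : z ∈ S) :
    partialDeriv j f z ⬝ᵥ g z + f z ⬝ᵥ partialDeriv j g z =
      if j = 2 then φ' (z 2) else 0 := by
  have hf' := (((hf.contDiffAt (hS.mem_nhds hz)).differentiableAt (by simp)).hasFDerivAt)
  have hg' := (((hg.contDiffAt (hS.mem_nhds hz)).differentiableAt (by simp)).hasFDerivAt)
  have h1 : HasFDerivAt (fun z => f z ⬝ᵥ g z)
      (∑ i : Fin 3, (f z i • (ContinuousLinearMap.proj i ∘L fderiv ℝ g z) +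
        g z i • (ContinuousLinearMap.proj i ∘L fderiv ℝ f z))) z :=
    HasFDerivAt.fun_sum fun i _ => (hasFDerivAt_pi'.1 hf' i).mul (hasFDerivAt_pi'.1 hg' i)
  have h2 : HasFDerivAt (fun z : Fin 3 → ℝ => φ (z 2))
      (φ' (z 2) • (ContinuousLinearMap.proj (R := ℝ) (φ := fun _ : Fin 3 => ℝ) 2)) z :=
    (hφ (z 2)).comp_hasFDerivAt z (hasFDerivAt_apply 2 z)
  have h3 := h2.congr_of_eventuallyEq (Filter.eventually_of_mem (hS.mem_nhds hz) h)
  have h4 := congrArg (fun L => L (Pi.single j 1)) (h1.unique h3)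
  simp only [dotProduct, partialDeriv, Fin.sum_univ_three] at h4 ⊢
  simp only [_root_.add_apply, _root_.smul_apply,
    ContinuousLinearMap.comp_apply, ContinuousLinearMap.proj_apply, smul_eq_mul] at h4
  have h5 : φ' (z 2) * (Pi.single j (1 : ℝ) : Fin 3 → ℝ) 2 = if j = 2 then φ' (z 2) else 0 := by
    simp [Pi.single_apply, eq_comm]
  rw [h5] at h4
  rw [← h4]
  ring

theorem isOpen_slab {ω : Set (ℝ × ℝ)} (hω : IsOpen ω) (h : ℝ) : IsOpen (slab ω h) :=
  (hω.preimage (f := fun z : Fin 3 → ℝ => (z 0, z 1)) (by fun_prop)).inter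
    (isOpen_Ioo.preimage (continuous_apply 2))

/-- The flatness condition for a block metric `E dx₁² + 2F dx₁dx₃ + H dx₃² + dx₂²` of constant
determinant whose coefficients depend on `x₃` only. -/
theorem second_deriv_eq_zero_of_metric {S : Set (Fin 3 → ℝ)} (hS : IsOpen S)
    {v : (Fin 3 → ℝ) → Fin 3 → ℝ} (hv : ContDiffOn ℝ (⊤ : ℕ∞) v S)
    {E F H E' F' H' E'' : ℝ → ℝ} {a : ℝ} (ha : a ≠ 0)
    (hE : ∀ t, HasDerivAt E (E' t) t) (hF : ∀ t, HasDerivAt F (F' t) t)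
    (hH : ∀ t, HasDerivAt H (H' t) t) (hE' : ∀ t, HasDerivAt E' (E'' t) t)
    (hdet : ∀ t, E t * H t - F t ^ 2 = a)
    (hinv : ∀ z ∈ S, (Dmat v z).det ≠ 0)
    (hmet : ∀ z ∈ S, (Dmat v z)ᵀ * Dmat v z =
      !![E (z 2), 0, F (z 2); 0, 1, 0; F (z 2), 0, H (z 2)])
    {z : Fin 3 → ℝ} (hz : z ∈ S) : E'' (z 2) = 0 := by
  have hd (j : Fin 3) := hv.partialDeriv hS j
  have hdd (i j : Fin 3) := (hd j).partialDeriv hS i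
  have entry (i j : Fin 3) (z) (hz : z ∈ S) : partialDeriv i v z ⬝ᵥ partialDeriv j v z =
      !![E (z 2), 0, F (z 2); 0, 1, 0; F (z 2), 0, H (z 2)] i j := by
    rw [← hmet z hz]; rfl
  have comm (i j : Fin 3) (z) (hz : z ∈ S) := partialDeriv_comm hS hv i j hz
  have dE (j z) (hz : z ∈ S) := partialDeriv_dotProduct_eq hS (hd 0) (hd 0) hE (entry 0 0) j hz
  have dF (j z) (hz : z ∈ S) := partialDeriv_dotProduct_eq hS (hd 0) (hd 2) hF (entry 0 2) j hz
  have dH (j z) (hz : z ∈ S) := partialDeriv_dotProduct_eq hS (hd 2) (hd 2) hH (entry 2 2) j hz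
  have d01 (j z) (hz : z ∈ S) := partialDeriv_dotProduct_eq hS (hd 0) (hd 1)
    (fun t => hasDerivAt_const t (0 : ℝ)) (entry 0 1) j hz
  have d12 (j z) (hz : z ∈ S) := partialDeriv_dotProduct_eq hS (hd 1) (hd 2)
    (fun t => hasDerivAt_const t (0 : ℝ)) (entry 1 2) j hz
  -- Christoffel symbols of the first kind
  have c00_0 (z) (hz : z ∈ S) :
      partialDeriv 0 (partialDeriv 0 v) z ⬝ᵥ partialDeriv 0 v z = 0 := by
    have := dE 0 z hz
    rw [dotProduct_comm (partialDeriv 0 v z)] at this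
    simp at this; linarith
  have c02_0 (z) (hz : z ∈ S) :
      partialDeriv 0 (partialDeriv 2 v) z ⬝ᵥ partialDeriv 0 v z = E' (z 2) / 2 := by
    have := dE 2 z hz
    rw [dotProduct_comm (partialDeriv 0 v z), comm 2 0 z hz] at this
    simp at this; linarith
  have c00_2 (z) (hz : z ∈ S) :
      partialDeriv 0 (partialDeriv 0 v) z ⬝ᵥ partialDeriv 2 v z = -(E' (z 2)) / 2 := by
    have := dF 0 z hz
    rw [dotProduct_comm (partialDeriv 0 v z), c02_0 z hz] at this
    simp at this; linarith
  have c01_0 (z) (hz : z ∈ S) :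
      partialDeriv 0 (partialDeriv 1 v) z ⬝ᵥ partialDeriv 0 v z = 0 := by
    have := dE 1 z hz
    rw [dotProduct_comm (partialDeriv 0 v z), comm 1 0 z hz] at this
    simp at this; linarith
  have c00_1 (z) (hz : z ∈ S) :
      partialDeriv 0 (partialDeriv 0 v) z ⬝ᵥ partialDeriv 1 v z = 0 := by
    have := d01 0 z hz
    rw [dotProduct_comm (partialDeriv 0 v z), c01_0 z hz] at this
    simp at this; linarith
  have c22_2 (z) (hz : z ∈ S) :
      partialDeriv 2 (partialDeriv 2 v) z ⬝ᵥ partialDeriv 2 v z = H' (z 2) / 2 := by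
    have := dH 2 z hz
    rw [dotProduct_comm (partialDeriv 2 v z)] at this
    simp at this; linarith
  have c02_2 (z) (hz : z ∈ S) :
      partialDeriv 0 (partialDeriv 2 v) z ⬝ᵥ partialDeriv 2 v z = 0 := by
    have := dH 0 z hz
    rw [dotProduct_comm (partialDeriv 2 v z)] at this
    simp at this; linarith
  have c22_0 (z) (hz : z ∈ S) :
      partialDeriv 2 (partialDeriv 2 v) z ⬝ᵥ partialDeriv 0 v z = F' (z 2) := by
    have := dF 2 z hz
    rw [dotProduct_comm (partialDeriv 0 v z), comm 2 0 z hz, c02_2 z hz] at this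
    simp at this; linarith
  have c02_1 (z) (hz : z ∈ S) :
      partialDeriv 0 (partialDeriv 2 v) z ⬝ᵥ partialDeriv 1 v z = 0 := by
    have h1 := dF 1 z hz
    have h2 := d01 2 z hz
    have h3 := d12 0 z hz
    rw [dotProduct_comm (partialDeriv 0 v z), comm 1 0 z hz] at h1
    rw [dotProduct_comm (partialDeriv 0 v z), comm 2 0 z hz, comm 2 1 z hz] at h2
    rw [dotProduct_comm (partialDeriv 1 v z)] at h3
    simp at h1 h2 h3; linarith
  -- the Gauss equation
  have g1 := partialDeriv_dotProduct_eq hS (hdd 0 0) (hd 2)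
    (fun t => ((hE' t).neg.div_const 2)) c00_2 2 hz
  have g2 := partialDeriv_dotProduct_eq hS (hdd 0 2) (hd 2)
    (fun t => hasDerivAt_const t (0 : ℝ)) c02_2 0 hz
  have third : partialDeriv 2 (partialDeriv 0 (partialDeriv 0 v)) z =
      partialDeriv 0 (partialDeriv 0 (partialDeriv 2 v)) z := by
    rw [partialDeriv_comm hS (hd 0) 2 0 hz]
    have : partialDeriv 2 (partialDeriv 0 v) =ᶠ[nhds z] partialDeriv 0 (partialDeriv 2 v) :=
      Filter.eventually_of_mem (hS.mem_nhds hz) (comm 2 0)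
    exact congrArg (fun L : (Fin 3 → ℝ) →L[ℝ] (Fin 3 → ℝ) => L (Pi.single 0 1)) this.fderiv_eq
  rw [third] at g1
  have lin (w : Fin 3 → ℝ) (hw : ∀ j, w ⬝ᵥ partialDeriv j v z = 0) : w = 0 := by
    refine eq_zero_of_vecMul_eq_zero (hinv z hz) (funext fun j => hw j)
  have e00 := entry 0 0 z hz
  have e02 := entry 0 2 z hz
  have e01 := entry 0 1 z hz
  have e21 := entry 2 1 z hz
  have e22 := entry 2 2 z hz
  have e20 := entry 2 0 z hz
  have hdz := hdet (z 2)
  have x1 : a • partialDeriv 0 (partialDeriv 0 v) z -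
      ((F (z 2) * E' (z 2) / 2) • partialDeriv 0 v z -
        (E (z 2) * E' (z 2) / 2) • partialDeriv 2 v z) = 0 := by
    refine lin _ fun j => ?_
    fin_cases j <;>
    simp [sub_dotProduct, c00_0 z hz, c00_1 z hz, c00_2 z hz, e00, e01, e02, e20, e21, e22, ← hdz]
      <;> ring
  have x2 : a • partialDeriv 0 (partialDeriv 2 v) z -
      ((H (z 2) * E' (z 2) / 2) • partialDeriv 0 v z -
        (F (z 2) * E' (z 2) / 2) • partialDeriv 2 v z) = 0 := by
    refine lin _ fun j => ?_
    fin_cases j <;>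
    simp [sub_dotProduct, c02_0 z hz, c02_1 z hz, c02_2 z hz, e00, e01, e02, e20, e21, e22, ← hdz]
      <;> ring
  have y1 := congrArg (fun w => w ⬝ᵥ partialDeriv 2 (partialDeriv 2 v) z) x1
  have y2 := congrArg (fun w => w ⬝ᵥ partialDeriv 0 (partialDeriv 2 v) z) x2
  simp only [sub_dotProduct, smul_dotProduct, zero_dotProduct, smul_eq_mul,
    dotProduct_comm (partialDeriv 0 v z), dotProduct_comm (partialDeriv 2 v z),
    c22_0 z hz, c22_2 z hz, c02_0 z hz, c02_2 z hz] at y1 y2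
  have hdet' : E' (z 2) * H (z 2) + E (z 2) * H' (z 2) - 2 * F (z 2) * F' (z 2) = 0 := by
    have h1 := ((hE (z 2)).mul (hH (z 2))).sub ((hF (z 2)).pow 2)
    have h2 : HasDerivAt (fun _ : ℝ => a) _ (z 2) :=
      h1.congr_of_eventuallyEq (Filter.Eventually.of_forall fun t => (hdet t).symm)
    have := h2.unique (hasDerivAt_const _ _)
    simpa using this
  simp at g1 g2
  have : a * E'' (z 2) = 0 := by
    linear_combination 2 * a * g1 - 2 * a * g2 - 2 * y1 + 2 * y2 + E' (z 2) / 2 * hdet'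
  exact (mul_eq_zero.1 this).resolve_left ha

/-- the splay-bend spontaneous strain `G(z₃) = I₃ + (a−1) n(z₃)⊗n(z₃)` is
kinematically incompatible: no smooth `v : Ω_h → ℝ³` with `det Dv > 0` satisfies
`(Dv)ᵀ Dv = G(z₃)` on `Ω_h`. -/
theorem stmt10 (ω : Set (ℝ × ℝ)) (hω : IsOpen ω) (hne : ω.Nonempty)
    (h a : ℝ) (hh : 0 < h) (ha : 0 < a) (ha1 : a ≠ 1) :
    ¬ ∃ v : (Fin 3 → ℝ) → (Fin 3 → ℝ),
      ContDiffOn ℝ (⊤ : ℕ∞) v (slab ω h) ∧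
      ∀ z ∈ slab ω h,
        0 < (Dmat v z).det ∧
        (Dmat v z)ᵀ * Dmat v z =
          1 + (a - 1) • Matrix.vecMulVec (nSB h (z 2)) (nSB h (z 2)) := by
  rintro ⟨v, hv, hG⟩
  obtain ⟨p, hp⟩ := hne
  set k := π / (2 * h) with hk
  have hk0 : 0 < k := by positivity
  have hθ (t : ℝ) : HasDerivAt (fun t => π / 4 + k * t) k t := by
    simpa using ((hasDerivAt_id t).const_mul k).const_add (π / 4)
  have hc (t : ℝ) := (hθ t).cos
  have hs (t : ℝ) := (hθ t).sin
  have hz : ![p.1, p.2, h / 4] ∈ slab ω h := by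
    refine ⟨hp, ?_, ?_⟩ <;> simp <;> linarith
  have key := second_deriv_eq_zero_of_metric (isOpen_slab hω h) hv ha.ne'
    (E := fun t => 1 + (a - 1) * cos (π / 4 + k * t) ^ 2)
    (F := fun t => (a - 1) * (cos (π / 4 + k * t) * sin (π / 4 + k * t)))
    (H := fun t => 1 + (a - 1) * sin (π / 4 + k * t) ^ 2)
    (fun t => (((hc t).pow 2).const_mul (a - 1)).const_add 1)
    (fun t => ((hc t).mul (hs t)).const_mul (a - 1))
    (fun t => (((hs t).pow 2).const_mul (a - 1)).const_add 1)
    (fun t => ((((hc t).pow 1).const_mul 2).mul ((hs t).neg.mul_const k)).const_mul (a - 1))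
    (fun t => by linear_combination (a - 1) * sin_sq_add_cos_sq (π / 4 + k * t))
    (fun z hz => (hG z hz).1.ne')
    (fun z hz => by
      rw [(hG z hz).2]
      ext i j
      fin_cases i <;> fin_cases j <;> simp [nSB, ← hk] <;>
        exact Or.inl (by ring))
    hz
  have h38 : π / 4 + k * (h / 4) = (3 * π / 4) / 2 := by
    rw [hk]; field_simp; ring
  have hcos : cos (3 * π / 4) < 0 :=
    cos_neg_of_pi_div_two_lt_of_lt (by linarith [pi_pos]) (by linarith [pi_pos])
  have hdouble : cos (3 * π / 4) = cos (3 * π / 4 / 2) ^ 2 - sin (3 * π / 4 / 2) ^ 2 := by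
    rw [← cos_two_mul']; congr 1; ring
  have hzero : (a - 1) * k ^ 2 * cos (3 * π / 4) = 0 := by
    rw [hdouble]
    simp [h38] at key
    rcases key with key | key
    · simp [key]
    · linear_combination -(a - 1) / 2 * key
  exact (mul_ne_zero (mul_ne_zero (sub_ne_zero.2 ha1) (pow_ne_zero 2 hk0.ne')) hcos.ne) hzero
end

section
/- Let ω ⊆ ℝ² be a nonempty open set, h > 0, and Ω_h = ω × (−h/2, h/2) ⊆ ℝ³. Let a > 0 with a ≠ 1, and for z = (z₁, z₂, z₃) ∈ Ω_h define the unit vector n(z₃) = (cos(π/4 + (π/(2h))·z₃), sin(π/4 + (π/(2h))·z₃), 0) and the positive definite symmetric matrix G(z₃) = I₃ + (a − 1)·n(z₃)⊗n(z₃). Then there exists no smooth (C^∞) map v : Ω_h → ℝ³ such that det Dv(z) > 0 and (Dv(z))ᵀ·Dv(z) = G(z₃) for every z ∈ Ω_h (twisted spontaneous strains are kinematically incompatible). -/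
open Matrix Real

/-- The twisted director `n(z₃) = (cos(π/4 + (π/(2h))z₃), sin(π/4 + (π/(2h))z₃), 0)`. -/
noncomputable def nT (h t : ℝ) : Fin 3 → ℝ :=
  ![Real.cos (π / 4 + π / (2 * h) * t), Real.sin (π / 4 + π / (2 * h) * t), 0]

/-- The partial derivative of `f` in the `i`-th coordinate direction. -/
noncomputable def pderiv (i : Fin 3) (f : (Fin 3 → ℝ) → (Fin 3 → ℝ)) (z : Fin 3 → ℝ) :
    Fin 3 → ℝ :=
  fderiv ℝ f z (Pi.single i 1)

theorem contDiffOn_pderiv {U : Set (Fin 3 → ℝ)} (hU : IsOpen U)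
    {f : (Fin 3 → ℝ) → (Fin 3 → ℝ)} (hf : ContDiffOn ℝ (⊤ : ℕ∞) f U) (i : Fin 3) :
    ContDiffOn ℝ (⊤ : ℕ∞) (pderiv i f) U :=
  (hf.fderiv_of_isOpen hU (by simp)).clm_apply contDiffOn_const

theorem pderiv_comm {U : Set (Fin 3 → ℝ)} (hU : IsOpen U)
    {f : (Fin 3 → ℝ) → (Fin 3 → ℝ)} (hf : ContDiffOn ℝ (⊤ : ℕ∞) f U) {z : Fin 3 → ℝ}
    (hz : z ∈ U) (i j : Fin 3) :
    pderiv i (pderiv j f) z = pderiv j (pderiv i f) z := by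
  have hd : DifferentiableAt ℝ (fderiv ℝ f) z :=
    ((hf.fderiv_of_isOpen (m := (⊤ : ℕ∞)) hU (by simp)).contDiffAt
      (hU.mem_nhds hz)).differentiableAt (by simp)
  have key (k l : Fin 3) : pderiv k (pderiv l f) z
      = fderiv ℝ (fderiv ℝ f) z (Pi.single k 1) (Pi.single l 1) := by
    unfold pderiv
    rw [fderiv_clm_apply hd (differentiableAt_const _)]
    simp
  rw [key, key]
  have hs : IsSymmSndFDerivAt ℝ f z :=
    (hf.contDiffAt (hU.mem_nhds hz)).isSymmSndFDerivAt (by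
      simp only [minSmoothness_of_isRCLikeNormedField]
      exact WithTop.coe_le_coe.mpr (le_top : (2 : ℕ∞) ≤ ⊤))
  exact hs _ _

/-- Product rule for a dot product that depends on the third coordinate only. -/
theorem pderiv_dotProduct {U : Set (Fin 3 → ℝ)} (hU : IsOpen U)
    {f g : (Fin 3 → ℝ) → (Fin 3 → ℝ)} (hf : ContDiffOn ℝ (⊤ : ℕ∞) f U)
    (hg : ContDiffOn ℝ (⊤ : ℕ∞) g U) {φ : ℝ → ℝ} {φ' : ℝ}
    (hφ : ∀ z ∈ U, f z ⬝ᵥ g z = φ (z 2)) {z : Fin 3 → ℝ} (hz : z ∈ U)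
    (hd : HasDerivAt φ φ' (z 2)) (i : Fin 3) :
    pderiv i f z ⬝ᵥ g z + pderiv i g z ⬝ᵥ f z = φ' * (Pi.single i 1 : Fin 3 → ℝ) 2 := by
  have hf' := ((hf.contDiffAt (hU.mem_nhds hz)).differentiableAt (by simp)).hasFDerivAt
  have hg' := ((hg.contDiffAt (hU.mem_nhds hz)).differentiableAt (by simp)).hasFDerivAt
  rw [hasFDerivAt_pi'] at hf' hg'
  have h1 := HasFDerivAt.fun_sum (u := Finset.univ) fun k _ => (hf' k).mul (hg' k)
  have h2 : HasFDerivAt (fun y : Fin 3 → ℝ => φ (y 2)) _ z :=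
    hd.comp_hasFDerivAt z (hasFDerivAt_apply (𝕜 := ℝ) 2 z)
  have h3 := h2.congr_of_eventuallyEq
    (Filter.eventually_of_mem (hU.mem_nhds hz) hφ)
  have h4 := DFunLike.congr_fun (h1.unique h3) (Pi.single i 1)
  simp [Fin.sum_univ_three] at h4
  simp only [pderiv, dotProduct, Fin.sum_univ_three]
  simp only [Pi.single_apply] at h4 ⊢
  linarith

/-- The derivative of the strain `1 + (a - 1) n ⊗ n` with respect to the third coordinate. -/
theorem hasDerivAt_strain (h a t : ℝ) (i j : Fin 3) :
    HasDerivAt (fun t => (1 + (a - 1) • vecMulVec (nT h t) (nT h t)) i j)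
      ((a - 1) * (π / (2 * h) *
        (![-sin (π / 4 + π / (2 * h) * t), cos (π / 4 + π / (2 * h) * t), 0] i * nT h t j +
        nT h t i *
          ![-sin (π / 4 + π / (2 * h) * t), cos (π / 4 + π / (2 * h) * t), 0] j))) t := by
  have hn (k : Fin 3) : HasDerivAt (fun t => nT h t k) (π / (2 * h) *
      ![-sin (π / 4 + π / (2 * h) * t), cos (π / 4 + π / (2 * h) * t), 0] k) t := by
    have hl : HasDerivAt (fun t => π / 4 + π / (2 * h) * t) (π / (2 * h)) t := by
      simpa using ((hasDerivAt_id t).const_mul (π / (2 * h))).const_add (π / 4)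
    fin_cases k
    · simpa [nT, mul_comm] using hl.cos
    · simpa [nT, mul_comm] using hl.sin
    · simpa [nT] using hasDerivAt_const t (0 : ℝ)
  have := (((hn i).mul (hn j)).const_mul (a - 1)).const_add ((1 : Matrix (Fin 3) (Fin 3) ℝ) i j)
  refine this.congr_deriv ?_
  ring

/-- the twisted spontaneous strain `G(z₃) = I₃ + (a−1) n(z₃)⊗n(z₃)` is
kinematically incompatible: no smooth `v : Ω_h → ℝ³` with `det Dv > 0` satisfies
`(Dv)ᵀ Dv = G(z₃)` on `Ω_h`. -/
theorem stmt11 (ω : Set (ℝ × ℝ)) (hω : IsOpen ω) (hne : ω.Nonempty)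
    (h a : ℝ) (hh : 0 < h) (ha : 0 < a) (ha1 : a ≠ 1) :
    ¬ ∃ v : (Fin 3 → ℝ) → (Fin 3 → ℝ),
      ContDiffOn ℝ (⊤ : ℕ∞) v (slab ω h) ∧
      ∀ z ∈ slab ω h,
        0 < (Dmat v z).det ∧
        (Dmat v z)ᵀ * Dmat v z =
          1 + (a - 1) • Matrix.vecMulVec (nT h (z 2)) (nT h (z 2)) := by
  rintro ⟨v, hv, hG⟩
  have hU := isOpen_slab hω h
  obtain ⟨⟨x, y⟩, hxy⟩ := hne
  have hz : ![x, y, 0] ∈ slab ω h := by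
    refine ⟨by simpa using hxy, ?_, ?_⟩ <;> simp <;> linarith
  have he (j) := contDiffOn_pderiv hU hv j
  have hH (i j) := contDiffOn_pderiv hU (he j) i
  have hdot (j k) (z) (hz : z ∈ slab ω h) : pderiv j v z ⬝ᵥ pderiv k v z =
      (1 + (a - 1) • vecMulVec (nT h (z 2)) (nT h (z 2))) j k := by
    rw [← (hG z hz).2]; rfl
  have hA (i j k) (z) (hz : z ∈ slab ω h) :=
    pderiv_dotProduct hU (he j) (he k) (hdot j k) hz (hasDerivAt_strain h a (z 2) j k) i
  have hS (i j) (z) (hz : z ∈ slab ω h) := pderiv_comm hU hv hz i j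
  have htan (i j k : Fin 3) (hi : i ≠ 2) (hj : j ≠ 2) (hk : k ≠ 2) (z) (hz : z ∈ slab ω h) :
      pderiv i (pderiv j v) z ⬝ᵥ pderiv k v z = 0 := by
    have h1 := hA i j k z hz
    have h2 := hA j i k z hz
    have h3 := hA k i j z hz
    rw [Pi.single_eq_of_ne (Ne.symm ‹_›), mul_zero] at h1 h2 h3
    rw [hS j i z hz] at h2
    rw [hS k i z hz, hS k j z hz] at h3
    linarith
  set z : Fin 3 → ℝ := ![x, y, 0]
  have hunit : pderiv 2 v z ⬝ᵥ pderiv 2 v z = 1 := by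
    rw [hdot 2 2 z hz]; simp [nT]
  have hnormal (i j : Fin 3) (hi : i ≠ 2) (hj : j ≠ 2) :
      ∃ c : ℝ, pderiv i (pderiv j v) z = c • pderiv 2 v z ∧
        -2 * c = (a - 1) * (π / (2 * h) *
        (![-sin (π / 4 + π / (2 * h) * z 2), cos (π / 4 + π / (2 * h) * z 2), 0] i *
          nT h (z 2) j + nT h (z 2) i *
          ![-sin (π / 4 + π / (2 * h) * z 2), cos (π / 4 + π / (2 * h) * z 2), 0] j)) := by
    refine ⟨pderiv i (pderiv j v) z ⬝ᵥ pderiv 2 v z, ?_, ?_⟩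
    · have horth (k : Fin 3) (hk : k ≠ 2) : pderiv 2 v z ⬝ᵥ pderiv k v z = 0 := by
        rw [hdot 2 k z hz]; fin_cases k <;> simp [nT] at hk ⊢
      rw [← sub_eq_zero]
      refine eq_zero_of_mulVec_eq_zero (M := (Dmat v z)ᵀ)
        (by rw [det_transpose]; exact (hG z hz).1.ne') ?_
      ext k
      change pderiv k v z ⬝ᵥ _ = 0
      rw [dotProduct_comm, sub_dotProduct, smul_dotProduct]
      by_cases hk : k = 2
      · subst hk; simp [hunit]
      · simp [horth k hk, htan i j k hi hj hk z hz]
    · have h1 := hA i j 2 z hz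
      have h2 := hA j i 2 z hz
      have h3 := hA 2 i j z hz
      rw [Pi.single_eq_of_ne (Ne.symm ‹_›), mul_zero] at h1 h2
      rw [Pi.single_eq_same, mul_one, hS 2 i z hz, hS 2 j z hz] at h3
      rw [hS j i z hz] at h2
      rw [← h3]
      linarith
  have hgauss : pderiv 1 (pderiv 1 v) z ⬝ᵥ pderiv 0 (pderiv 0 v) z =
      pderiv 0 (pderiv 1 v) z ⬝ᵥ pderiv 0 (pderiv 1 v) z := by
    have h1 := pderiv_dotProduct hU (hH 1 1) (he 0) (φ := fun _ => 0)
      (htan 1 1 0 (by decide) (by decide) (by decide)) hz (hasDerivAt_const _ _) 0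
    have h2 := pderiv_dotProduct hU (hH 0 1) (he 0) (φ := fun _ => 0)
      (htan 0 1 0 (by decide) (by decide) (by decide)) hz (hasDerivAt_const _ _) 1
    rw [pderiv_comm hU (he 1) hz, dotProduct_comm (pderiv 0 (pderiv 0 v) z)] at h1
    rw [hS 1 0 z hz] at h2
    linarith
  obtain ⟨c00, e00, h00⟩ := hnormal 0 0 (by decide) (by decide)
  obtain ⟨c01, e01, h01⟩ := hnormal 0 1 (by decide) (by decide)
  obtain ⟨c11, e11, h11⟩ := hnormal 1 1 (by decide) (by decide)
  rw [e00, e01, e11] at hgauss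
  simp only [smul_dotProduct, dotProduct_smul, hunit, smul_eq_mul, mul_one] at hgauss
  have hcs := sin_sq_add_cos_sq (π / 4 + π / (2 * h) * z 2)
  simp only [nT, cons_val_zero, cons_val_one] at h00 h01 h11
  set s := sin (π / 4 + π / (2 * h) * z 2)
  set c := cos (π / 4 + π / (2 * h) * z 2)
  have hp : π / (2 * h) ≠ 0 := by positivity
  set p := π / (2 * h)
  have hne : (a - 1) * p ≠ 0 := mul_ne_zero (sub_ne_zero.mpr ha1) hp
  have hsq : ((a - 1) * p) ^ 2 * (s ^ 2 + c ^ 2) ^ 2 = 0 := by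
    have h4 : (-2 * c11) * (-2 * c00) = (-2 * c01) * (-2 * c01) := by linear_combination 4 * hgauss
    rw [h00, h01, h11] at h4
    linear_combination -h4
  rw [hcs] at hsq
  exact hne (by simpa using hsq)
end

section
/- Let k ∈ ℝ with k ≠ 0, let h > 0 satisfy h/2 < 1/|k|, let ω ⊆ ℝ² be open, and let Ω_h = ω × (−h/2, h/2). Define v : Ω_h → ℝ³ by v(z₁, z₂, z₃) = ( (1/k − z₃)·sin(k z₁), z₂, (1/k − z₃)·cos(k z₁) ). Then v is smooth, Dv(z) is invertible for every z ∈ Ω_h, and (Dv(z))ᵀ·Dv(z) = diag( (1 − k z₃)², 1, 1 ) for every z ∈ Ω_h; in particular, the quadratic-in-thickness spontaneous strain G(z₃) = diag(1 − 2k z₃ + k² z₃², 1, 1) is kinematically compatible. -/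
open Matrix Real

/-- The deformation `v(z₁,z₂,z₃) = ((1/k − z₃) sin(k z₁), z₂, (1/k − z₃) cos(k z₁))`. -/
noncomputable def bendDef (k : ℝ) (z : Fin 3 → ℝ) : Fin 3 → ℝ :=
  ![(1 / k - z 2) * Real.sin (k * z 0), z 1, (1 / k - z 2) * Real.cos (k * z 0)]

theorem contDiff_bendDef (k : ℝ) {n : WithTop ℕ∞} : ContDiff ℝ n (bendDef k) := by
  refine contDiff_pi.2 fun i => ?_
  fin_cases i <;> simp [bendDef] <;> fun_prop

theorem Dmat_apply_of_hasFDerivAt {v : (Fin 3 → ℝ) → (Fin 3 → ℝ)} {z : Fin 3 → ℝ}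
    (hv : DifferentiableAt ℝ v z) {i : Fin 3} {v' : (Fin 3 → ℝ) →L[ℝ] ℝ}
    (hvi : HasFDerivAt (fun x => v x i) v' z) (j : Fin 3) :
    Dmat v z i j = v' (Pi.single j 1) := by
  rw [← (hasFDerivAt_pi'.1 hv.hasFDerivAt i).unique hvi]
  rfl

theorem Dmat_bendDef {k : ℝ} (hk : k ≠ 0) (z : Fin 3 → ℝ) :
    Dmat (bendDef k) z =
      !![(1 - k * z 2) * cos (k * z 0), 0, -sin (k * z 0);
        0, 1, 0;
        -((1 - k * z 2) * sin (k * z 0)), 0, -cos (k * z 0)] := by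
  have coord (i : Fin 3) : HasFDerivAt (fun x : Fin 3 → ℝ => x i)
      (ContinuousLinearMap.proj (R := ℝ) (φ := fun _ : Fin 3 => ℝ) i) z := hasFDerivAt_apply i z
  have radius := (coord 2).const_sub (1 / k)
  have angle := (coord 0).const_mul k
  have hv : DifferentiableAt ℝ (bendDef k) z :=
    (contDiff_bendDef k (n := 1)).differentiable one_ne_zero z
  have row₀ := Dmat_apply_of_hasFDerivAt hv (i := 0) (radius.mul angle.sin)
  have row₁ := Dmat_apply_of_hasFDerivAt hv (i := 1) (coord 1)
  have row₂ := Dmat_apply_of_hasFDerivAt hv (i := 2) (radius.mul angle.cos)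
  ext i j
  fin_cases i <;> fin_cases j <;> simp [row₀, row₁, row₂] <;> field_simp

theorem transpose_Dmat_bendDef_mul_self {k : ℝ} (hk : k ≠ 0) (z : Fin 3 → ℝ) :
    (Dmat (bendDef k) z)ᵀ * Dmat (bendDef k) z =
      Matrix.diagonal ![(1 - k * z 2) ^ 2, 1, 1] := by
  have trig := sin_sq_add_cos_sq (k * z 0)
  rw [Dmat_bendDef hk]
  ext i j
  fin_cases i <;> fin_cases j <;> simp [Matrix.mul_apply, Fin.sum_univ_three] <;>
    first | ring1 | linear_combination trig | linear_combination (1 - k * z 2) ^ 2 * trig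

theorem isUnit_Dmat_bendDef {k : ℝ} (hk : k ≠ 0) {z : Fin 3 → ℝ} (hz : 1 - k * z 2 ≠ 0) :
    IsUnit (Dmat (bendDef k) z) := by
  have hdet : (Dmat (bendDef k) z).det = -(1 - k * z 2) := by
    rw [Dmat_bendDef hk, Matrix.det_fin_three]
    simp
    linear_combination -(1 - k * z 2) * sin_sq_add_cos_sq (k * z 0)
  rw [Matrix.isUnit_iff_isUnit_det, hdet]
  exact (neg_ne_zero.2 hz).isUnit

theorem one_sub_mul_pos_of_mem_slab {k h : ℝ} (hk : k ≠ 0) (hhk : h / 2 < 1 / |k|)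
    {ω : Set (ℝ × ℝ)} {z : Fin 3 → ℝ} (hz : z ∈ slab ω h) : 0 < 1 - k * z 2 := by
  have hlt : |z 2| * |k| < 1 :=
    (lt_div_iff₀ (abs_pos.2 hk)).1 ((abs_lt.2 hz.2).trans hhk)
  rw [mul_comm, ← abs_mul] at hlt
  linarith [le_abs_self (k * z 2)]

/-- `v` is smooth, has invertible Jacobian on `Ω_h`, and realises
`(Dv)ᵀ Dv = diag((1 − k z₃)², 1, 1)`; so the strain
`G(z₃) = diag(1 − 2k z₃ + k² z₃², 1, 1)` is kinematically compatible. -/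
theorem stmt13 (k h : ℝ) (hk : k ≠ 0) (hh : 0 < h) (hhk : h / 2 < 1 / |k|)
    (ω : Set (ℝ × ℝ)) (hω : IsOpen ω) :
    ContDiffOn ℝ (⊤ : ℕ∞) (bendDef k) (slab ω h) ∧
    ∀ z ∈ slab ω h,
      IsUnit (Dmat (bendDef k) z) ∧
      (Dmat (bendDef k) z)ᵀ * Dmat (bendDef k) z =
        Matrix.diagonal ![(1 - k * z 2) ^ 2, 1, 1] ∧
      Matrix.diagonal ![(1 - k * z 2) ^ 2, 1, 1] =
        Matrix.diagonal ![1 - 2 * k * z 2 + k ^ 2 * (z 2) ^ 2, 1, 1] := by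
  refine ⟨(contDiff_bendDef k).contDiffOn, fun z hz =>
    ⟨isUnit_Dmat_bendDef hk (one_sub_mul_pos_of_mem_slab hk hhk hz).ne',
      transpose_Dmat_bendDef_mul_self hk z, ?_⟩⟩
  congr 2
  ring
end

section
/- Let ω ⊆ ℝ² be an open convex set containing the origin, let k ∈ ℝ with k ≠ 0, and let y : ω → ℝ³ be a smooth map satisfying: (∇y)ᵀ·∇y = I₂ on ω; A_y(x) = diag(k, 0) for every x ∈ ω, where ν = ∂₁y × ∂₂y and (A_y)_{ij} = ∂ᵢy · ∂ⱼν; y(0,0) = 0; ∂₁y(0,0) = e₁; and ∂₂y(0,0) = e₂. Then y(x₁, x₂) = ( (1/k)·sin(k x₁), x₂, (1/k)·(cos(k x₁) − 1) ) for every (x₁, x₂) ∈ ω; i.e., the deformed surface is a portion of a cylinder of radius 1/|k|. -/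
open Matrix Real

/-- Partial derivative `∂ᵢ y` of a map `y : ℝ² → ℝ³`. -/
noncomputable def pd (y : (Fin 2 → ℝ) → (Fin 3 → ℝ)) (i : Fin 2) (x : Fin 2 → ℝ) :
    Fin 3 → ℝ :=
  fderiv ℝ y x (Pi.single i 1)

/-- The normal `ν = ∂₁y × ∂₂y`. -/
noncomputable def nuVec (y : (Fin 2 → ℝ) → (Fin 3 → ℝ)) (x : Fin 2 → ℝ) : Fin 3 → ℝ :=
  crossProduct (pd y 0 x) (pd y 1 x)

/-- The second fundamental form `(A_y)ᵢⱼ = ∂ᵢy · ∂ⱼν`. -/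
noncomputable def sff (y : (Fin 2 → ℝ) → (Fin 3 → ℝ)) (x : Fin 2 → ℝ) :
    Matrix (Fin 2) (Fin 2) ℝ :=
  Matrix.of fun i j => pd y i x ⬝ᵥ fderiv ℝ (nuVec y) x (Pi.single j 1)

/-- A vector orthogonal to `u`, `v` and `n`, where `u, v, n` are orthonormal, vanishes. -/
lemma eq_zero_of_dotProduct_orthonormal {u v n w : Fin 3 → ℝ}
    (huu : u ⬝ᵥ u = 1) (hvv : v ⬝ᵥ v = 1) (hnn : n ⬝ᵥ n = 1) (huv : u ⬝ᵥ v = 0)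
    (hun : u ⬝ᵥ n = 0) (hvn : v ⬝ᵥ n = 0)
    (hu : u ⬝ᵥ w = 0) (hv : v ⬝ᵥ w = 0) (hn : n ⬝ᵥ w = 0) : w = 0 := by
  have hM : Matrix.of ![u, v, n] * (Matrix.of ![u, v, n])ᵀ = 1 := by
    ext i j
    have h : (Matrix.of ![u, v, n] * (Matrix.of ![u, v, n])ᵀ) i j =
        ![u, v, n] i ⬝ᵥ ![u, v, n] j := rfl
    rw [h]
    fin_cases i <;> fin_cases j <;>
      simp [huu, hvv, hnn, huv, hun, hvn, dotProduct_comm v u, dotProduct_comm n u,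
        dotProduct_comm n v]
  have hM' := mul_eq_one_comm.mp hM
  have hw : Matrix.of ![u, v, n] *ᵥ w = 0 := by
    ext i
    fin_cases i
    · exact hu
    · exact hv
    · exact hn
  rw [← Matrix.one_mulVec w, ← hM', ← Matrix.mulVec_mulVec, hw, Matrix.mulVec_zero]

/-- Product rule for a dot product which is locally constant. -/
lemma dotProduct_fderiv_add_eq_zero {a b : (Fin 2 → ℝ) → (Fin 3 → ℝ)} {ω : Set (Fin 2 → ℝ)}
    (hω : IsOpen ω) {c : ℝ} (hc : ∀ x ∈ ω, a x ⬝ᵥ b x = c) {x : Fin 2 → ℝ} (hx : x ∈ ω)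
    (ha : DifferentiableAt ℝ a x) (hb : DifferentiableAt ℝ b x) (w : Fin 2 → ℝ) :
    b x ⬝ᵥ fderiv ℝ a x w + a x ⬝ᵥ fderiv ℝ b x w = 0 := by
  have ha' := hasFDerivAt_pi'.mp ha.hasFDerivAt
  have hb' := hasFDerivAt_pi'.mp hb.hasFDerivAt
  have h := HasFDerivAt.fun_sum (u := Finset.univ) fun i _ => (ha' i).mul (hb' i)
  have h0 : HasFDerivAt (fun x => ∑ i, a x i * b x i) (0 : (Fin 2 → ℝ) →L[ℝ] ℝ) x :=
    (hasFDerivAt_const c x).congr_of_eventuallyEq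
      (Filter.eventuallyEq_of_mem (hω.mem_nhds hx) hc)
  have h1 := congrArg (fun L => L w) (h.unique h0)
  simp [Fin.sum_univ_three] at h1
  simp only [dotProduct, Fin.sum_univ_three]
  linarith

/-- On a convex open set, a map with vanishing partial derivatives is constant. -/
lemma eq_of_partial_fderiv_eq_zero {f : (Fin 2 → ℝ) → (Fin 3 → ℝ)} {ω : Set (Fin 2 → ℝ)}
    (hω : IsOpen ω) (hconv : Convex ℝ ω) (hf : ∀ x ∈ ω, DifferentiableAt ℝ f x)
    (h : ∀ x ∈ ω, ∀ j : Fin 2, fderiv ℝ f x (Pi.single j 1) = 0)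
    {x z : Fin 2 → ℝ} (hx : x ∈ ω) (hz : z ∈ ω) : f x = f z := by
  refine hω.is_const_of_fderiv_eq_zero hconv.isPreconnected
    (fun x hx => (hf x hx).differentiableWithinAt) (fun x hx => ?_) hx hz
  ext w : 1
  have hw : w = w 0 • Pi.single 0 1 + w 1 • Pi.single 1 1 := by
    ext i; fin_cases i <;> simp
  rw [hw, map_add, map_smul, map_smul, h x hx, h x hx]
  simp

lemma dotProduct_self_cross_eq_one {u v : Fin 3 → ℝ} (huu : u ⬝ᵥ u = 1) (hvv : v ⬝ᵥ v = 1)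
    (huv : u ⬝ᵥ v = 0) : crossProduct u v ⬝ᵥ crossProduct u v = 1 := by
  rw [cross_dot_cross, huu, hvv, huv, dotProduct_comm v u, huv]
  norm_num

lemma fderiv_trig_combination {u n : (Fin 2 → ℝ) → (Fin 3 → ℝ)} {x : Fin 2 → ℝ}
    (hu : DifferentiableAt ℝ u x) (hn : DifferentiableAt ℝ n x) (k s : ℝ) :
    DifferentiableAt ℝ (fun z => Real.cos (k * z 0 + s) • u z + Real.sin (k * z 0 + s) • n z) x ∧
    ∀ w, fderiv ℝ (fun z => Real.cos (k * z 0 + s) • u z + Real.sin (k * z 0 + s) • n z) x w =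
      Real.cos (k * x 0 + s) • (fderiv ℝ u x w + (k * w 0) • n x) +
        Real.sin (k * x 0 + s) • (fderiv ℝ n x w - (k * w 0) • u x) := by
  have hl : HasFDerivAt (fun z : Fin 2 → ℝ => k * z 0 + s)
      (k • ContinuousLinearMap.proj (R := ℝ) (φ := fun _ : Fin 2 => ℝ) 0) x :=
    ((hasFDerivAt_apply (𝕜 := ℝ) (0 : Fin 2) x).const_mul k).add_const s
  have h := (hl.cos.smul hu.hasFDerivAt).add (hl.sin.smul hn.hasFDerivAt)
  refine ⟨h.differentiableAt, fun w => ?_⟩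
  refine (congrArg (fun L => L w) h.fderiv).trans ?_
  ext i
  simp
  ring

/-- a smooth isometric immersion `y` of an open convex `ω ∋ 0` with
`A_y ≡ diag(k,0)` (`k ≠ 0`) and normalisation `y(0)=0`, `∂₁y(0)=e₁`, `∂₂y(0)=e₂` is
the cylinder `y(x₁,x₂) = ((1/k) sin(k x₁), x₂, (1/k)(cos(k x₁) − 1))`. -/
theorem stmt15 (ω : Set (Fin 2 → ℝ)) (hω : IsOpen ω) (hconv : Convex ℝ ω)
    (h0 : (0 : Fin 2 → ℝ) ∈ ω) (k : ℝ) (hk : k ≠ 0)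
    (y : (Fin 2 → ℝ) → (Fin 3 → ℝ)) (hy : ContDiffOn ℝ (⊤ : ℕ∞) y ω)
    (hiso : ∀ x ∈ ω, ∀ i j : Fin 2, pd y i x ⬝ᵥ pd y j x = (1 : Matrix (Fin 2) (Fin 2) ℝ) i j)
    (hA : ∀ x ∈ ω, sff y x = Matrix.diagonal ![k, 0])
    (hy0 : y 0 = 0) (hd1 : pd y 0 0 = ![1, 0, 0]) (hd2 : pd y 1 0 = ![0, 1, 0]) :
    ∀ x ∈ ω, y x = ![(1 / k) * Real.sin (k * x 0), x 1,
      (1 / k) * (Real.cos (k * x 0) - 1)] := by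
  have hyat : ∀ x ∈ ω, ContDiffAt ℝ (⊤ : ℕ∞) y x := fun x hx => hy.contDiffAt (hω.mem_nhds hx)
  have hdy : ∀ x ∈ ω, DifferentiableAt ℝ y x := fun x hx => (hyat x hx).differentiableAt (by simp)
  have h2 : (2 : WithTop ℕ∞) ≤ ((⊤ : ℕ∞) : WithTop ℕ∞) := 
    WithTop.coe_le_coe.mpr (le_top : (2 : ℕ∞) ≤ ⊤)
  have hddy : ∀ x ∈ ω, DifferentiableAt ℝ (fderiv ℝ y) x := fun x hx =>
    ((hyat x hx).fderiv_right (m := 1) (by rwa [one_add_one_eq_two])).differentiableAt (by simp)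
  have hpd : ∀ x ∈ ω, ∀ i, DifferentiableAt ℝ (pd y i) x := fun x hx i =>
    (hddy x hx).clm_apply (differentiableAt_const _)
  have hpd_apply : ∀ x ∈ ω, ∀ i w,
      fderiv ℝ (pd y i) x w = fderiv ℝ (fderiv ℝ y) x w (Pi.single i 1) := by
    intro x hx i w
    have := (hddy x hx).hasFDerivAt.clm_apply (hasFDerivAt_const (Pi.single i (1 : ℝ)) x)
    refine (congrArg (fun L => L w) this.fderiv).trans ?_
    simp
  have hsymm : ∀ x ∈ ω, fderiv ℝ (pd y 0) x (Pi.single 1 1) =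
      fderiv ℝ (pd y 1) x (Pi.single 0 1) := by
    intro x hx
    rw [hpd_apply x hx, hpd_apply x hx]
    exact (hyat x hx).isSymmSndFDerivAt (by simpa using h2) _ _
  have hnu : ∀ x ∈ ω, DifferentiableAt ℝ (nuVec y) x := by
    intro x hx
    have h1 := differentiableAt_pi.mp (hpd x hx 0)
    have h2 := differentiableAt_pi.mp (hpd x hx 1)
    refine differentiableAt_pi.mpr fun i => ?_
    simp only [nuVec, cross_apply]
    fin_cases i
    · exact ((h1 1).mul (h2 2)).sub ((h1 2).mul (h2 1))
    · exact ((h1 2).mul (h2 0)).sub ((h1 0).mul (h2 2))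
    · exact ((h1 0).mul (h2 1)).sub ((h1 1).mul (h2 0))
  have huu : ∀ x ∈ ω, pd y 0 x ⬝ᵥ pd y 0 x = 1 := fun x hx => by simpa using hiso x hx 0 0
  have hvv : ∀ x ∈ ω, pd y 1 x ⬝ᵥ pd y 1 x = 1 := fun x hx => by simpa using hiso x hx 1 1
  have huv : ∀ x ∈ ω, pd y 0 x ⬝ᵥ pd y 1 x = 0 := fun x hx => by simpa using hiso x hx 0 1
  have hun : ∀ x ∈ ω, pd y 0 x ⬝ᵥ nuVec y x = 0 := fun x _ => dot_self_cross _ _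
  have hvn : ∀ x ∈ ω, pd y 1 x ⬝ᵥ nuVec y x = 0 := fun x _ => dot_cross_self _ _
  have hnn : ∀ x ∈ ω, nuVec y x ⬝ᵥ nuVec y x = 1 := fun x hx =>
    dotProduct_self_cross_eq_one (huu x hx) (hvv x hx) (huv x hx)
  have hS : ∀ x ∈ ω, ∀ i j, pd y i x ⬝ᵥ fderiv ℝ (nuVec y) x (Pi.single j 1) =
      Matrix.diagonal ![k, 0] i j := fun x hx i j => congrFun (congrFun (hA x hx) i) j
  have key : ∀ x ∈ ω,
      (fderiv ℝ (pd y 0) x (Pi.single 0 1) = -(k • nuVec y x)) ∧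
      (fderiv ℝ (pd y 0) x (Pi.single 1 1) = 0) ∧
      (fderiv ℝ (pd y 1) x (Pi.single 0 1) = 0) ∧
      (fderiv ℝ (pd y 1) x (Pi.single 1 1) = 0) ∧
      (fderiv ℝ (nuVec y) x (Pi.single 0 1) = k • pd y 0 x) ∧
      (fderiv ℝ (nuVec y) x (Pi.single 1 1) = 0) := by
    intro x hx
    have zero_of {w : Fin 3 → ℝ} := eq_zero_of_dotProduct_orthonormal (w := w)
      (huu x hx) (hvv x hx) (hnn x hx) (huv x hx) (hun x hx) (hvn x hx)
    have duu w := dotProduct_fderiv_add_eq_zero hω huu hx (hpd x hx 0) (hpd x hx 0) w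
    have dvv w := dotProduct_fderiv_add_eq_zero hω hvv hx (hpd x hx 1) (hpd x hx 1) w
    have duv w := dotProduct_fderiv_add_eq_zero hω huv hx (hpd x hx 0) (hpd x hx 1) w
    have dun w := dotProduct_fderiv_add_eq_zero hω hun hx (hpd x hx 0) (hnu x hx) w
    have dvn w := dotProduct_fderiv_add_eq_zero hω hvn hx (hpd x hx 1) (hnu x hx) w
    have dnn w := dotProduct_fderiv_add_eq_zero hω hnn hx (hnu x hx) (hnu x hx) w
    have s := hsymm x hx
    have s00 := hS x hx 0 0
    have s01 := hS x hx 0 1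
    have s10 := hS x hx 1 0
    have s11 := hS x hx 1 1
    simp at s00 s01 s10 s11
    have a0 := huu x hx
    have a1 := huv x hx
    have a2 := hun x hx
    have a3 := hvn x hx
    have a4 := hnn x hx
    have u0 := duu (Pi.single 0 1)
    have u1 := duu (Pi.single 1 1)
    have v0 := dvv (Pi.single 0 1)
    have v1 := dvv (Pi.single 1 1)
    have uv0 := duv (Pi.single 0 1)
    have uv1 := duv (Pi.single 1 1)
    have un0 := dun (Pi.single 0 1)
    have un1 := dun (Pi.single 1 1)
    have vn0 := dvn (Pi.single 0 1)
    have vn1 := dvn (Pi.single 1 1)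
    have n0 := dnn (Pi.single 0 1)
    have n1 := dnn (Pi.single 1 1)
    rw [← s] at v0 uv0 vn0 ⊢
    have a2' := dotProduct_comm (nuVec y x) (pd y 0 x)
    have a1' := dotProduct_comm (pd y 1 x) (pd y 0 x)
    refine ⟨eq_neg_of_add_eq_zero_left (zero_of ?_ ?_ ?_), zero_of ?_ ?_ ?_, zero_of ?_ ?_ ?_,
      zero_of ?_ ?_ ?_, sub_eq_zero.mp (zero_of ?_ ?_ ?_), zero_of ?_ ?_ ?_⟩ <;>
    (try simp only [dotProduct_add, dotProduct_sub, dotProduct_smul, smul_eq_mul, a0, a1, a2, a3, a4,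
      a2', a1', mul_zero, mul_one]) <;> linarith
  have hv : ∀ x ∈ ω, pd y 1 x = ![0, 1, 0] := fun x hx => by
    rw [← hd2]
    refine eq_of_partial_fderiv_eq_zero hω hconv (fun x hx => hpd x hx 1) (fun x hx j => ?_) hx h0
    obtain ⟨-, -, h1, h2, -⟩ := key x hx
    fin_cases j
    · exact h1
    · exact h2
  have hrot : ∀ s : ℝ, ∀ x ∈ ω,
      Real.cos (k * x 0 + s) • pd y 0 x + Real.sin (k * x 0 + s) • nuVec y x =
        ![Real.cos s, 0, Real.sin s] := by
    intro s x hx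
    have hn0 : nuVec y 0 = ![0, 0, 1] := by
      rw [nuVec, hd1, hd2]; simp [cross_apply]
    refine (eq_of_partial_fderiv_eq_zero hω hconv
      (fun x hx => (fderiv_trig_combination (hpd x hx 0) (hnu x hx) k s).1)
      (fun x hx j => ?_) hx h0).trans ?_
    · rw [(fderiv_trig_combination (hpd x hx 0) (hnu x hx) k s).2]
      obtain ⟨h1, h2, -, -, h3, h4⟩ := key x hx
      fin_cases j
      · simp [h1, h3]
      · simp [h2, h4]
    · simp [hd1, hn0]
  have hu : ∀ x ∈ ω, pd y 0 x = ![Real.cos (k * x 0), 0, -Real.sin (k * x 0)] := by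
    intro x hx
    have h := hrot (-(k * x 0)) x hx
    simpa using h
  intro x hx
  have hg : ∀ x : Fin 2 → ℝ, HasFDerivAt (fun x : Fin 2 → ℝ => ![(1 / k) * Real.sin (k * x 0), x 1,
      (1 / k) * (Real.cos (k * x 0) - 1)]) (ContinuousLinearMap.pi
        ![Real.cos (k * x 0) • ContinuousLinearMap.proj (R := ℝ) (φ := fun _ : Fin 2 => ℝ) 0,
          ContinuousLinearMap.proj 1, (-Real.sin (k * x 0)) • ContinuousLinearMap.proj 0]) x := by
    intro x
    have hl := (hasFDerivAt_apply (𝕜 := ℝ) (0 : Fin 2) x).const_mul k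
    refine hasFDerivAt_pi.mpr fun i => ?_
    fin_cases i
    · refine (hl.sin.const_mul (1 / k)).congr_fderiv ?_
      ext w
      simp
      field_simp
    · exact hasFDerivAt_apply (𝕜 := ℝ) (1 : Fin 2) x
    · refine ((hl.cos.sub_const 1).const_mul (1 / k)).congr_fderiv ?_
      ext w
      simp
      field_simp
  have h := eq_of_partial_fderiv_eq_zero hω hconv
    (fun x hx => (hdy x hx).sub (hg x).differentiableAt) (fun x hx j => ?_) hx h0
  · refine sub_eq_zero.mp (h.trans ?_)
    simp [hy0]
  · rw [((hdy x hx).hasFDerivAt.sub (hg x)).fderiv, _root_.sub_apply, sub_eq_zero]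
    fin_cases j
    · refine (hu x hx).trans ?_
      ext i
      fin_cases i <;> simp
    · refine (hv x hx).trans ?_
      ext i
      fin_cases i <;> simp
end

section
/- Let γ ≥ 0 and m₀ ∈ ℝ with m₀ ≠ 0, and set k̄ = m₀·(1+2γ)/(1+γ). Then the minimum over all 2×2 real symmetric matrices A with det A = 0 of |A − m₀·I₂|² + γ·(tr A − 2m₀)² equals m₀²·(1+2γ)/(1+γ), and the set of minimizers is exactly { R · diag(k̄, 0) · Rᵀ : R ∈ SO(2) }; in particular the minimum is attained on a continuous one-parameter family of matrices (zero-stiffness structure). -/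
open Matrix Real

/-- On singular symmetric matrices the energy is a quadratic polynomial in the trace. -/
theorem energy_eq_of_det_eq_zero {γ : ℝ} (hγ : 1 + γ ≠ 0) (m₀ : ℝ)
    {A : Matrix (Fin 2) (Fin 2) ℝ} (hA : A.IsSymm) (hdet : A.det = 0) :
    frobSq (A - m₀ • (1 : Matrix (Fin 2) (Fin 2) ℝ)) + γ * (A.trace - 2 * m₀) ^ 2 =
      m₀ ^ 2 * (1 + 2 * γ) / (1 + γ) +
        (1 + γ) * (A.trace - m₀ * (1 + 2 * γ) / (1 + γ)) ^ 2 := by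
  have h10 : A 1 0 = A 0 1 := hA.apply 0 1
  rw [Matrix.det_fin_two, h10] at hdet
  simp only [frobSq, Matrix.trace_fin_two, Fin.sum_univ_two, Matrix.sub_apply, Matrix.smul_apply,
    Matrix.one_apply, smul_eq_mul, h10]
  simp
  field_simp
  linear_combination (-2 * (1 + γ)) * hdet

/-- Conjugating `diag(k, 0)` by a rotation whose first column is `(c, s)`. -/
theorem rotation_conj_diagonal (c s k : ℝ) :
    !![c, -s; s, c] * Matrix.diagonal ![k, 0] * (!![c, -s; s, c])ᵀ =
      !![k * c ^ 2, k * (c * s); k * (c * s), k * s ^ 2] := by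
  ext i j
  fin_cases i <;> fin_cases j <;> simp [Matrix.mul_apply, Matrix.vecMul_diagonal] <;> ring

/-- A singular symmetric `2 × 2` matrix of nonzero trace is diagonalised by a rotation. -/
theorem exists_rotation_of_det_eq_zero {A : Matrix (Fin 2) (Fin 2) ℝ} (hA : A.IsSymm)
    (hdet : A.det = 0) (htr : A.trace ≠ 0) :
    ∃ R : Matrix (Fin 2) (Fin 2) ℝ, Rᵀ * R = 1 ∧ R.det = 1 ∧
      A = R * Matrix.diagonal ![A.trace, 0] * Rᵀ := by
  have h10 : A 1 0 = A 0 1 := hA.apply 0 1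
  rw [Matrix.det_fin_two, h10] at hdet
  set k := A.trace with hk
  rw [Matrix.trace_fin_two] at hk
  obtain ⟨c, s, hc, hcs, hs⟩ :
      ∃ c s : ℝ, A 0 0 = k * c ^ 2 ∧ A 0 1 = k * (c * s) ∧ A 1 1 = k * s ^ 2 := by
    by_cases ha : A 0 0 = 0
    · refine ⟨0, 1, by simp [ha], ?_, by linarith⟩
      have : A 0 1 ^ 2 = 0 := by rw [ha] at hdet; linarith
      simpa using this
    · have hpos : 0 < A 0 0 / k := by
        have h : A 0 0 / k = (A 0 0 ^ 2 + A 0 1 ^ 2) / k ^ 2 := by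
          field_simp
          linear_combination A 0 0 * hk + hdet
        rw [h]
        positivity
      have hsq : √(A 0 0 / k) ^ 2 = A 0 0 / k := Real.sq_sqrt hpos.le
      have hne : √(A 0 0 / k) ≠ 0 := (Real.sqrt_pos.2 hpos).ne'
      refine ⟨√(A 0 0 / k), A 0 1 / (k * √(A 0 0 / k)), ?_, ?_, ?_⟩
      · rw [hsq]; field_simp
      · field_simp
      · rw [div_pow, mul_pow, hsq]
        field_simp
        linear_combination hdet
  have hunit : c ^ 2 + s ^ 2 = 1 :=
    mul_left_cancel₀ htr (by linear_combination -hc - hs - hk)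
  refine ⟨!![c, -s; s, c], ?_, ?_, ?_⟩
  · ext i j
    fin_cases i <;> fin_cases j <;> simp [Matrix.mul_apply, Fin.sum_univ_two] <;> grind
  · rw [Matrix.det_fin_two_of]
    linear_combination hunit
  · rw [rotation_conj_diagonal, Matrix.eta_fin_two A, h10, hc, hcs, hs]

/-- for `γ ≥ 0`, `m₀ ≠ 0` and `k̄ = m₀ (1+2γ)/(1+γ)`, the minimum over
2×2 symmetric `A` with `det A = 0` of `|A − m₀ I₂|² + γ (tr A − 2m₀)²` equals
`m₀² (1+2γ)/(1+γ)`, and the minimisers are exactly `{R diag(k̄,0) Rᵀ : R ∈ SO(2)}`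
(a continuous one-parameter family: zero-stiffness structure). -/
theorem stmt19 (γ m₀ : ℝ) (hγ : 0 ≤ γ) (hm : m₀ ≠ 0) :
    IsLeast {x : ℝ | ∃ A : Matrix (Fin 2) (Fin 2) ℝ, A.IsSymm ∧ A.det = 0 ∧
        x = frobSq (A - m₀ • (1 : Matrix (Fin 2) (Fin 2) ℝ)) + γ * (A.trace - 2 * m₀) ^ 2}
      (m₀ ^ 2 * (1 + 2 * γ) / (1 + γ)) ∧
    ∀ A : Matrix (Fin 2) (Fin 2) ℝ, A.IsSymm → A.det = 0 →
      (frobSq (A - m₀ • (1 : Matrix (Fin 2) (Fin 2) ℝ)) + γ * (A.trace - 2 * m₀) ^ 2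
          = m₀ ^ 2 * (1 + 2 * γ) / (1 + γ) ↔
        ∃ R : Matrix (Fin 2) (Fin 2) ℝ, Rᵀ * R = 1 ∧ R.det = 1 ∧
          A = R * Matrix.diagonal ![m₀ * (1 + 2 * γ) / (1 + γ), 0] * Rᵀ) := by
  have hpos : 0 < 1 + γ := by linarith
  have hk : m₀ * (1 + 2 * γ) / (1 + γ) ≠ 0 :=
    div_ne_zero (mul_ne_zero hm (by positivity)) hpos.ne'
  refine ⟨⟨⟨Matrix.diagonal ![m₀ * (1 + 2 * γ) / (1 + γ), 0], Matrix.isSymm_diagonal _,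
    by simp, ?_⟩, ?_⟩, fun A hA hdet => ?_⟩
  · rw [energy_eq_of_det_eq_zero hpos.ne' m₀ (Matrix.isSymm_diagonal _) (by simp)]
    simp
  · rintro x ⟨A, hA, hdet, rfl⟩
    rw [energy_eq_of_det_eq_zero hpos.ne' m₀ hA hdet]
    exact le_add_of_nonneg_right (by positivity)
  · rw [energy_eq_of_det_eq_zero hpos.ne' m₀ hA hdet, add_eq_left, mul_eq_zero_iff_left hpos.ne',
      sq_eq_zero_iff, sub_eq_zero]
    refine ⟨fun htr => ?_, ?_⟩
    · rw [← htr] at hk ⊢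
      exact exists_rotation_of_det_eq_zero hA hdet hk
    · rintro ⟨R, hR, -, rfl⟩
      rw [Matrix.trace_mul_comm, ← Matrix.mul_assoc, hR, Matrix.one_mul]
      simp
end
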